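/- Let s, s' ∈ ℝ with s + s' ≥ −1/2 and s' ≤ −1/2, and fix a sign ±. There exists C > 0 such that for all Schwartz functions u, v on ℝ²: ‖ P^+( T_{P^± v} P^+ u ) ‖_{X^{s+s'+1, −1/2, 1}} ≤ C ‖u‖_{X^{s, 1/2, 1}} ‖v‖_{X^{s', 1/2, 1}}. -/

import Mathlib

open MeasureTheory SchwartzMap
open scoped FourierTransform ENNReal NNReal

noncomputable section

/-- Fourier transform on `ℝ` (pointwise Fourier integral). -/
def FT (g : ℝ → ℂ) : ℝ → ℂ := 𝓕 g

/-- Inverse Fourier transform on `ℝ`. -/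
def FTinv (g : ℝ → ℂ) : ℝ → ℂ := 𝓕⁻ g

/-- `φ` is an admissible Littlewood–Paley filter: a Schwartz function whose Fourier
transform equals `1` on `|ξ| ≤ 1` and `0` on `|ξ| ≥ 2`. -/
def IsLPfilter (φ : 𝓢(ℝ, ℂ)) : Prop :=
  (∀ ξ : ℝ, |ξ| ≤ 1 → FT (⇑φ) ξ = 1) ∧ (∀ ξ : ℝ, 2 ≤ |ξ| → FT (⇑φ) ξ = 0)

/-- `S_j f = φ_j * f`, where `φ_j(x) = 2^j φ(2^j x)`. -/
def LPS (φ : ℝ → ℂ) (j : ℕ) (f : ℝ → ℂ) : ℝ → ℂ :=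
  fun x => ∫ y : ℝ, ((2 : ℝ) ^ j : ℝ) * φ ((2 : ℝ) ^ j * (x - y)) * f y

/-- Space–time Fourier transform on `ℝ²`, `(t,x) ↦ (τ,ξ)`. -/
def FT2 (u : ℝ × ℝ → ℂ) (q : ℝ × ℝ) : ℂ :=
  ∫ p : ℝ × ℝ,
    Complex.exp (-(2 * Real.pi * Complex.I) * ((p.1 * q.1 + p.2 * q.2 : ℝ) : ℂ)) * u p

/-- Inverse space–time Fourier transform on `ℝ²`. -/
def FT2inv (u : ℝ × ℝ → ℂ) (p : ℝ × ℝ) : ℂ :=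
  ∫ q : ℝ × ℝ,
    Complex.exp ((2 * Real.pi * Complex.I) * ((p.1 * q.1 + p.2 * q.2 : ℝ) : ℂ)) * u q

/-- The dyadic bump `ψ_{m-1}` (index shifted by one: `psiLP φ 0 = 𝓕φ` is the
low-frequency bump `ψ_{-1}`, and for `m ≥ 1`,
`psiLP φ m (ξ) = 𝓕φ(2^{-m} ξ) - 𝓕φ(2^{-(m-1)} ξ)` is `ψ_{m-1}`). -/
def psiLP (φ : 𝓢(ℝ, ℂ)) : ℕ → ℝ → ℂ
  | 0 => fun ξ => FT (⇑φ) ξ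
  | (n + 1) => fun ξ =>
      FT (⇑φ) ((2 : ℝ) ^ (-((n : ℝ) + 1)) * ξ) - FT (⇑φ) ((2 : ℝ) ^ (-(n : ℝ)) * ξ)

/-- The space–time block `Δ^±_{jk}` (sign `ε = ±1`), with both indices shifted by one
(`m, n : ℕ` correspond to `j = m - 1 ≥ -1`, `k = n - 1 ≥ -1`):
`Δ^±_{jk} w = 𝓕⁻¹(1_{±ξ ≥ 0} ψ_j(ξ) ψ_k(τ ∓ ξ²) 𝓕w)`. -/
def Xblock (φ : 𝓢(ℝ, ℂ)) (ε : ℝ) (m n : ℕ) (w : ℝ × ℝ → ℂ) : ℝ × ℝ → ℂ :=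
  FT2inv fun q =>
    (if 0 ≤ ε * q.2 then (1 : ℂ) else 0) * psiLP φ m q.2 *
      psiLP φ n (q.1 - ε * q.2 ^ 2) * FT2 w q

/-- The Bourgain norm `‖w‖_{X^{σ,b,1}} = Σ_{j,k ≥ -1} 2^{jσ + kb} ‖Δ_{jk} w‖_{L²}`,
where `Δ_{jk} = Δ^+_{jk} + Δ^-_{jk}` (indices shifted by one as in `Xblock`). -/
def XNorm (φ : 𝓢(ℝ, ℂ)) (σ b : ℝ) (w : ℝ × ℝ → ℂ) : ℝ≥0∞ :=
  ∑' m : ℕ, ∑' n : ℕ,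
    ENNReal.ofReal ((2 : ℝ) ^ (((m : ℝ) - 1) * σ + ((n : ℝ) - 1) * b)) *
      eLpNorm (fun p : ℝ × ℝ => Xblock φ 1 m n w p + Xblock φ (-1) m n w p) 2
        (volume : Measure (ℝ × ℝ))

/-- The spatial Fourier projection `P^±` onto `{± ξ ≥ 0}` (sign `ε = ±1`), acting in
the `x` variable for each fixed `t`. -/
def Pproj (ε : ℝ) (f : ℝ × ℝ → ℂ) : ℝ × ℝ → ℂ :=
  fun p => FTinv (fun ξ =>
    (if 0 ≤ ε * ξ then (1 : ℂ) else 0) * FT (fun y => f (p.1, y)) ξ) p.2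

/-- `S_j` acting in the `x` variable for each fixed `t`. -/
def Sx (φ : 𝓢(ℝ, ℂ)) (j : ℕ) (f : ℝ × ℝ → ℂ) : ℝ × ℝ → ℂ :=
  fun p => LPS (⇑φ) j (fun y => f (p.1, y)) p.2

/-- `Δ_j` acting in the `x` variable for each fixed `t`. -/
def Dx (φ : 𝓢(ℝ, ℂ)) (j : ℕ) (f : ℝ × ℝ → ℂ) : ℝ × ℝ → ℂ :=
  fun p => Sx φ (j + 1) f p - Sx φ j f p

/-- The paraproduct `T_g f = Σ_{j ≥ 1} S_{j-1} g · Δ_j f` (in the `x` variable). -/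
def paraT (φ : 𝓢(ℝ, ℂ)) (g f : ℝ × ℝ → ℂ) : ℝ × ℝ → ℂ :=
  fun p => ∑' i : ℕ, Sx φ i g p * Dx φ (i + 1) f p

/-- The remainder `R(f,g) = Σ_{j,j' ≥ 0, |j-j'| ≤ 1} Δ_j f · Δ_{j'} g` of the Bony
decomposition (in the `x` variable). -/
def remR (φ : 𝓢(ℝ, ℂ)) (f g : ℝ × ℝ → ℂ) : ℝ × ℝ → ℂ :=
  fun p => ∑' j : ℕ, ∑' j' : ℕ,
    if |(j : ℤ) - (j' : ℤ)| ≤ 1 then Dx φ j f p * Dx φ j' g p else 0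

/-- Spatial derivative `∂_x` of a space–time function. -/
def dX (f : ℝ × ℝ → ℂ) : ℝ × ℝ → ℂ := fun p => deriv (fun y => f (p.1, y)) p.2

section Plancherel

variable {V : Type*} [NormedAddCommGroup V] [InnerProductSpace ℝ V] [FiniteDimensional ℝ V]
  [MeasurableSpace V] [BorelSpace V]

theorem integral_fourier_mul_eq_flip {f g : V → ℂ} (hf : Integrable f) (hg : Integrable g) :
    ∫ ξ, 𝓕 f ξ * g ξ = ∫ x, f x * 𝓕 g x := by
  have := VectorFourier.integral_fourierIntegral_smul_eq_flip (μ := (volume : Measure V))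
    (ν := (volume : Measure V)) (L := innerₗ V) (f := f) (g := g)
    Real.continuous_fourierChar (by exact continuous_inner) hf hg
  rw [flip_innerₗ] at this
  simpa using! this

theorem integral_fourierInv_mul_eq_flip {f g : V → ℂ} (hf : Integrable f) (hg : Integrable g) :
    ∫ ξ, 𝓕⁻ f ξ * g ξ = ∫ x, f x * 𝓕⁻ g x := by
  have h1 : ∫ ξ, 𝓕⁻ f ξ * g ξ = ∫ ξ, 𝓕 f ξ * g (-ξ) := by
    rw [← integral_neg_eq_self]
    simp [Real.fourierInv_eq_fourier_neg]
  rw [h1, integral_fourier_mul_eq_flip hf hg.comp_neg]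
  simp [Real.fourierInv_eq_fourier_comp_neg]

theorem continuous_fourier_of_integrable {f : V → ℂ} (hf : Integrable f) : Continuous (𝓕 f) :=
  VectorFourier.fourierIntegral_continuous Real.continuous_fourierChar
    (by exact continuous_inner) hf

theorem continuous_fourierInv_of_integrable {f : V → ℂ} (hf : Integrable f) :
    Continuous (𝓕⁻ f) := by
  rw [Real.fourierInv_eq_fourier_comp_neg]
  exact continuous_fourier_of_integrable hf.comp_neg

open scoped ContDiff in
/-- Two locally integrable functions agreeing as distributions on Schwartz functions agree a.e. -/
theorem ae_eq_of_integral_schwartz_mul_eq {f f' : V → ℂ} (hf : LocallyIntegrable f)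
    (hf' : LocallyIntegrable f') (h : ∀ g : 𝓢(V, ℂ), ∫ x, f x * g x = ∫ x, f' x * g x) :
    f =ᵐ[volume] f' := by
  refine ae_eq_of_integral_contDiff_smul_eq hf hf' fun g hg hgc => ?_
  have hgc' : HasCompactSupport (fun x => (g x : ℂ)) :=
    HasCompactSupport.comp_left (g := ((↑) : ℝ → ℂ)) hgc Complex.ofReal_zero
  have hg' : ContDiff ℝ ∞ (fun x => (g x : ℂ)) := Complex.ofRealCLM.contDiff.comp hg
  have h1 := h (hgc'.toSchwartzMap hg')
  simp only [HasCompactSupport.toSchwartzMap_toFun] at h1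
  simpa only [Complex.real_smul, mul_comm] using h1

/-- **Fourier inversion**, almost everywhere. -/
theorem fourier_fourierInv_ae_eq {f : V → ℂ} (hf : Integrable f) (hf' : Integrable (𝓕⁻ f)) :
    𝓕 (𝓕⁻ f) =ᵐ[volume] f := by
  refine ae_eq_of_integral_schwartz_mul_eq
    (continuous_fourier_of_integrable hf').locallyIntegrable hf.locallyIntegrable fun g => ?_
  rw [integral_fourier_mul_eq_flip hf' g.integrable, ← SchwartzMap.fourier_coe,
    integral_fourierInv_mul_eq_flip hf ((𝓕 g : 𝓢(V, ℂ)).integrable (μ := volume)), ← SchwartzMap.fourierInv_coe,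
    FourierTransform.fourierInv_fourier_eq]

theorem fourierInv_ae_eq_lp {f : V → ℂ} (hf : Integrable f) (hf2 : MemLp f 2 volume) :
    𝓕⁻ f =ᵐ[volume] (𝓕⁻ (hf2.toLp f) : Lp ℂ 2 (volume : Measure V)) := by
  refine ae_eq_of_integral_schwartz_mul_eq
    (continuous_fourierInv_of_integrable hf).locallyIntegrable
    ((Lp.memLp _).locallyIntegrable (by norm_num)) fun g => ?_
  rw [integral_fourierInv_mul_eq_flip hf g.integrable]
  have h1 := Lp.toTemperedDistribution_apply (𝓕⁻ (hf2.toLp f) : Lp ℂ 2 (volume : Measure V)) g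
  rw [← Lp.fourierInv_toTemperedDistribution_eq, TemperedDistribution.fourierInv_apply,
    Lp.toTemperedDistribution_apply] at h1
  simp only [smul_eq_mul] at h1
  simp_rw [mul_comm _ (g _)]
  rw [← h1]
  refine integral_congr_ae ?_
  filter_upwards [hf2.coeFn_toLp] with x hx
  rw [hx, mul_comm, SchwartzMap.fourierInv_coe]

/-- **Plancherel's theorem** for the inverse Fourier integral on `L¹ ∩ L²`. -/
theorem eLpNorm_fourierInv_eq {f : V → ℂ} (hf : Integrable f)
    (hf2 : MemLp f 2 volume) :
    eLpNorm (𝓕⁻ f) 2 volume = eLpNorm f 2 volume := by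
  rw [eLpNorm_congr_ae (fourierInv_ae_eq_lp hf hf2), ← eLpNorm_congr_ae (MemLp.coeFn_toLp hf2)]
  have : ‖(𝓕⁻ (hf2.toLp f) : Lp ℂ 2 (volume : Measure V))‖ = ‖hf2.toLp f‖ :=
    (Lp.fourierTransformₗᵢ V ℂ).symm.norm_map _
  rw [← Lp.enorm_def, ← Lp.enorm_def, ← ofReal_norm, ← ofReal_norm, this]

end Plancherel

section Transfer

/-- The Euclidean plane, on which Mathlib's Fourier transform lives. -/
abbrev EPlane : Type := WithLp 2 (ℝ × ℝ)

/-- The identification of `ℝ × ℝ` with the Euclidean plane. -/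
abbrev planeEquiv : EPlane ≃L[ℝ] ℝ × ℝ := WithLp.prodContinuousLinearEquiv 2 ℝ ℝ ℝ

theorem measurePreserving_planeEquiv : MeasurePreserving planeEquiv volume volume :=
  WithLp.volume_preserving_ofLp ℝ ℝ

theorem measurePreserving_planeEquiv_symm : MeasurePreserving planeEquiv.symm volume volume :=
  WithLp.volume_preserving_toLp ℝ ℝ

theorem measurableEmbedding_planeEquiv : MeasurableEmbedding planeEquiv :=
  planeEquiv.toHomeomorph.measurableEmbedding

theorem FT2inv_eq_fourierInv (F : ℝ × ℝ → ℂ) :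
    FT2inv F = (𝓕⁻ (F ∘ planeEquiv)) ∘ planeEquiv.symm := by
  ext p
  rw [Function.comp_apply, Real.fourierInv_eq', FT2inv,
    ← measurePreserving_planeEquiv.integral_comp measurableEmbedding_planeEquiv]
  refine integral_congr_ae (.of_forall fun z => ?_)
  simp only [smul_eq_mul, Function.comp_apply, WithLp.prod_inner_apply]
  congr 2
  simp [mul_comm, mul_assoc]

theorem FT2_eq_fourier (F : ℝ × ℝ → ℂ) :
    FT2 F = (𝓕 (F ∘ planeEquiv)) ∘ planeEquiv.symm := by
  ext p
  rw [Function.comp_apply, Real.fourier_eq', FT2,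
    ← measurePreserving_planeEquiv.integral_comp measurableEmbedding_planeEquiv]
  refine integral_congr_ae (.of_forall fun z => ?_)
  simp only [smul_eq_mul, Function.comp_apply, WithLp.prod_inner_apply]
  congr 2
  simp [mul_comm, mul_assoc]

theorem integrable_comp_planeEquiv {F : ℝ × ℝ → ℂ} :
    Integrable (F ∘ planeEquiv) ↔ Integrable F :=
  measurePreserving_planeEquiv.integrable_comp_emb measurableEmbedding_planeEquiv

theorem continuous_FT2 {F : ℝ × ℝ → ℂ} (hF : Integrable F) : Continuous (FT2 F) := by
  rw [FT2_eq_fourier]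
  exact (continuous_fourier_of_integrable (integrable_comp_planeEquiv.2 hF)).comp
    planeEquiv.symm.continuous

theorem continuous_FT2inv {F : ℝ × ℝ → ℂ} (hF : Integrable F) : Continuous (FT2inv F) := by
  rw [FT2inv_eq_fourierInv]
  exact (continuous_fourierInv_of_integrable (integrable_comp_planeEquiv.2 hF)).comp
    planeEquiv.symm.continuous

/-- **Plancherel's theorem** for `FT2inv`. -/
theorem eLpNorm_FT2inv {F : ℝ × ℝ → ℂ} (hF : Integrable F) (hF2 : MemLp F 2 volume) :
    eLpNorm (FT2inv F) 2 volume = eLpNorm F 2 volume := by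
  have h := continuous_fourierInv_of_integrable (integrable_comp_planeEquiv.2 hF)
  rw [FT2inv_eq_fourierInv, eLpNorm_comp_measurePreserving h.aestronglyMeasurable
    measurePreserving_planeEquiv_symm, eLpNorm_fourierInv_eq (integrable_comp_planeEquiv.2 hF)
    (hF2.comp_measurePreserving measurePreserving_planeEquiv),
    eLpNorm_comp_measurePreserving hF2.1 measurePreserving_planeEquiv]

theorem FT2_FT2inv_ae_eq {F : ℝ × ℝ → ℂ} (hF : Integrable F) (hF' : Integrable (FT2inv F)) :
    FT2 (FT2inv F) =ᵐ[volume] F := by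
  have h1 : FT2inv F ∘ planeEquiv = 𝓕⁻ (F ∘ planeEquiv) := by
    rw [FT2inv_eq_fourierInv]; ext z; simp
  have h2 := integrable_comp_planeEquiv.2 hF'
  rw [h1] at h2
  have h3 := measurePreserving_planeEquiv_symm.quasiMeasurePreserving.ae_eq_comp
    (fourier_fourierInv_ae_eq (integrable_comp_planeEquiv.2 hF) h2)
  rw [FT2_eq_fourier, h1]
  refine h3.trans (.of_forall fun z => ?_)
  simp

theorem FT2_eq_zero_of_not_integrable {w : ℝ × ℝ → ℂ} (hw : ¬ Integrable w) : FT2 w = 0 := by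
  ext q
  refine integral_undef fun h => hw ?_
  have h1 := h.bdd_mul (c := 1)
    (f := fun p : ℝ × ℝ => Complex.exp ((2 * Real.pi * Complex.I) * ((p.1 * q.1 + p.2 * q.2 : ℝ) : ℂ)))
    (by fun_prop) (.of_forall fun p => by
      rw [Complex.norm_exp]; simp)
  refine h1.congr (.of_forall fun p => ?_)
  simp only
  rw [← mul_assoc, ← Complex.exp_add]
  simp

/-- The space–time Fourier transform of a Schwartz function is Schwartz, with inversion. -/
theorem exists_schwartz_FT2 (u : 𝓢(ℝ × ℝ, ℂ)) :
    ∃ W : 𝓢(ℝ × ℝ, ℂ), ⇑W = FT2 u ∧ FT2inv W = u := by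
  let u' : 𝓢(EPlane, ℂ) := compCLMOfContinuousLinearEquiv ℂ planeEquiv u
  refine ⟨compCLMOfContinuousLinearEquiv ℂ planeEquiv.symm (𝓕 u'), ?_, ?_⟩
  · rw [FT2_eq_fourier]
    simp only [compCLMOfContinuousLinearEquiv_apply, SchwartzMap.fourier_coe, u']
  · have h : (⇑(compCLMOfContinuousLinearEquiv ℂ planeEquiv.symm (𝓕 u')) ∘ planeEquiv) = 𝓕 u' := by
      ext z; simp
    rw [FT2inv_eq_fourierInv, h, ← SchwartzMap.fourierInv_coe,
      FourierTransform.fourierInv_fourier_eq]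
    ext z; simp [u']

end Transfer

section Product

/-- The character `p ↦ e^{2πi p·q}` of the plane. -/
def planeChar (p q : ℝ × ℝ) : ℂ :=
  Complex.exp ((2 * Real.pi * Complex.I) * ((p.1 * q.1 + p.2 * q.2 : ℝ) : ℂ))

theorem norm_planeChar (p q : ℝ × ℝ) : ‖planeChar p q‖ = 1 := by
  rw [planeChar, Complex.norm_exp]; simp

theorem continuous_planeChar (p : ℝ × ℝ) : Continuous (planeChar p) := by
  unfold planeChar; fun_prop

theorem planeChar_add (p q r : ℝ × ℝ) :
    planeChar p (q + r) = planeChar p q * planeChar p r := by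
  rw [planeChar, planeChar, planeChar, ← Complex.exp_add]
  congr 1; push_cast [Prod.fst_add, Prod.snd_add]; ring

theorem FT2inv_mul_FT2inv (F G : ℝ × ℝ → ℂ) (p : ℝ × ℝ) :
    FT2inv F p * FT2inv G p =
      ∫ z : (ℝ × ℝ) × (ℝ × ℝ), planeChar p (z.1 + z.2) * (F z.1 * G z.2) := by
  change (∫ r, planeChar p r * F r) * (∫ r, planeChar p r * G r) = _
  rw [← integral_prod_mul]
  refine integral_congr_ae (.of_forall fun z => ?_)
  simp only [planeChar_add]; ring

theorem integrable_diag {H : (ℝ × ℝ) × (ℝ × ℝ) → ℂ} (hH : Integrable H) :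
    Integrable (fun z : (ℝ × ℝ) × (ℝ × ℝ) => H (z.1, z.2 - z.1)) :=
  (measurePreserving_prod_sub (volume : Measure (ℝ × ℝ))
    (volume : Measure (ℝ × ℝ))).integrable_comp_of_integrable hH

theorem FT2inv_diag {H : (ℝ × ℝ) × (ℝ × ℝ) → ℂ} (hH : Integrable H) (p : ℝ × ℝ) :
    FT2inv (fun q => ∫ r, H (r, q - r)) p =
      ∫ z : (ℝ × ℝ) × (ℝ × ℝ), planeChar p (z.1 + z.2) * H z := by
  change ∫ q, planeChar p q * _ = _
  have hH' : Integrable (fun z => planeChar p (z.1 + z.2) * H z) :=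
    hH.bdd_mul (c := 1) (by have := continuous_planeChar p; fun_prop)
      (.of_forall fun z => (norm_planeChar _ _).le)
  have h2 := (measurePreserving_prod_sub (volume : Measure (ℝ × ℝ))
    (volume : Measure (ℝ × ℝ))).integral_comp (MeasurableEquiv.shearSubRight (ℝ × ℝ)).measurableEmbedding
      (fun z => planeChar p (z.1 + z.2) * H z)
  have h3 := integrable_diag hH'
  refine Eq.trans ?_ h2
  rw [integral_prod_symm _ h3]
  refine integral_congr_ae (.of_forall fun q => ?_)
  simp [integral_const_mul]

end Product

section Series

theorem integrable_tsum_of_lintegral {α : Type*} [MeasurableSpace α] {μ : Measure α}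
    {f : ℕ → α → ℂ} (hf : ∀ i, AEStronglyMeasurable (f i) μ)
    (hf' : ∑' i, ∫⁻ a, ‖f i a‖ₑ ∂μ ≠ ∞) : Integrable (fun a => ∑' i, f i a) μ := by
  have hf'' i : AEMeasurable (‖f i ·‖ₑ) μ := (hf i).enorm
  rw [← lintegral_tsum hf''] at hf'
  have hs : ∀ᵐ a ∂μ, Summable fun n => f n a := by
    refine (ae_lt_top' (AEMeasurable.tsum hf'') hf').mono fun x hx => ?_
    have : Summable fun n => (‖f n x‖₊ : ℝ) := by
      rw [← ENNReal.tsum_coe_ne_top_iff_summable_coe]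
      exact hx.ne
    exact this.of_norm
  refine ⟨aestronglyMeasurable_of_tendsto_ae Filter.atTop
    (f := fun n a => ∑ i ∈ Finset.range n, f i a)
    (fun n => Finset.aestronglyMeasurable_fun_sum _ fun i _ => hf i)
    (hs.mono fun a ha => ha.hasSum.tendsto_sum_nat), ?_⟩
  exact (lintegral_mono fun a => enorm_tsum_le_tsum_enorm).trans_lt hf'.lt_top

theorem lintegral_enorm_mul_prod {F G : ℝ × ℝ → ℂ} (hF : Integrable F) (hG : Integrable G) :
    ∫⁻ z : (ℝ × ℝ) × (ℝ × ℝ), ‖F z.1 * G z.2‖ₑ = (∫⁻ r, ‖F r‖ₑ) * ∫⁻ r, ‖G r‖ₑ := by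
  simp_rw [enorm_mul]
  exact lintegral_prod_mul hF.1.enorm hG.1.enorm

theorem integrable_tsum_mul {F G : ℕ → ℝ × ℝ → ℂ} (hF : ∀ i, Integrable (F i))
    (hG : ∀ i, Integrable (G i)) (h : ∑' i, (∫⁻ r, ‖F i r‖ₑ) * ∫⁻ r, ‖G i r‖ₑ ≠ ∞) :
    Integrable (fun z : (ℝ × ℝ) × (ℝ × ℝ) => ∑' i, F i z.1 * G i z.2) := by
  refine integrable_tsum_of_lintegral (fun i => ((hF i).mul_prod (hG i)).1) ?_
  simpa only [lintegral_enorm_mul_prod (hF _) (hG _)] using h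

/-- A series of products of inverse Fourier transforms is the inverse Fourier transform of the
corresponding series of convolutions. -/
theorem tsum_FT2inv_mul {F G : ℕ → ℝ × ℝ → ℂ} (hF : ∀ i, Integrable (F i))
    (hG : ∀ i, Integrable (G i)) (h : ∑' i, (∫⁻ r, ‖F i r‖ₑ) * ∫⁻ r, ‖G i r‖ₑ ≠ ∞)
    (p : ℝ × ℝ) :
    ∑' i, FT2inv (F i) p * FT2inv (G i) p =
      FT2inv (fun q => ∫ r, ∑' i, F i r * G i (q - r)) p := by
  rw [FT2inv_diag (H := fun z => ∑' i, F i z.1 * G i z.2) (integrable_tsum_mul hF hG h)]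
  simp_rw [FT2inv_mul_FT2inv]
  have hc : Continuous fun z : (ℝ × ℝ) × (ℝ × ℝ) => planeChar p (z.1 + z.2) :=
    (continuous_planeChar p).comp (by fun_prop)
  refine (Eq.trans (integral_congr_ae (.of_forall fun z => tsum_mul_left.symm))
    (integral_tsum (fun i => hc.aestronglyMeasurable.mul ((hF i).mul_prod (hG i)).1) ?_)).symm
  refine (tsum_congr fun i => ?_).trans_ne h
  rw [← lintegral_enorm_mul_prod (hF i) (hG i)]
  refine lintegral_congr fun z => ?_
  rw [Pi.mul_apply, enorm_mul, ← ofReal_norm, norm_planeChar, ENNReal.ofReal_one, one_mul]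

end Series

section Slice

/-- Inverse Fourier transform in the first variable. -/
def sliceInv (t : ℝ) (H : ℝ × ℝ → ℂ) (ξ : ℝ) : ℂ :=
  ∫ τ : ℝ, Complex.exp ((2 * Real.pi * Complex.I) * ((t * τ : ℝ) : ℂ)) * H (τ, ξ)

theorem integrable_exp_mul {H : ℝ × ℝ → ℂ} (hH : Integrable H) (t : ℝ) :
    Integrable fun q : ℝ × ℝ =>
      Complex.exp ((2 * Real.pi * Complex.I) * ((t * q.1 : ℝ) : ℂ)) * H q :=
  hH.bdd_mul (c := 1) (by fun_prop) (.of_forall fun p => by rw [Complex.norm_exp]; simp)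

theorem integrable_sliceInv {H : ℝ × ℝ → ℂ} (hH : Integrable H) (t : ℝ) :
    Integrable (sliceInv t H) :=
  (integrable_exp_mul hH t).integral_prod_right

theorem sliceInv_mul (m : ℝ → ℂ) (H : ℝ × ℝ → ℂ) (t : ℝ) :
    sliceInv t (fun q => m q.2 * H q) = fun ξ => m ξ * sliceInv t H ξ := by
  ext ξ
  simp only [sliceInv]
  rw [← integral_const_mul]
  congr 1; ext τ; ring

theorem FTinv_apply (f : ℝ → ℂ) (x : ℝ) :
    FTinv f x = ∫ ξ : ℝ, Complex.exp ((2 * Real.pi * Complex.I) * ((x * ξ : ℝ) : ℂ)) * f ξ := by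
  rw [FTinv, Real.fourierInv_eq']
  refine integral_congr_ae (.of_forall fun z => ?_)
  simp only [smul_eq_mul]
  congr 2
  simp only [RCLike.inner_apply, conj_trivial]
  push_cast; ring

theorem FT2inv_eq_FTinv_sliceInv {H : ℝ × ℝ → ℂ} (hH : Integrable H) (t x : ℝ) :
    FT2inv H (t, x) = FTinv (sliceInv t H) x := by
  have h1 : Integrable fun q : ℝ × ℝ => planeChar (t, x) q * H q :=
    hH.bdd_mul (c := 1) (continuous_planeChar _).aestronglyMeasurable
      (.of_forall fun z => (norm_planeChar _ _).le)
  rw [FTinv_apply]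
  change ∫ q, planeChar (t, x) q * H q = _
  refine (integral_prod_symm _ h1).trans (integral_congr_ae (.of_forall fun ξ => ?_))
  simp only [sliceInv, ← integral_const_mul, planeChar]
  refine integral_congr_ae (.of_forall fun τ => ?_)
  simp only
  rw [← mul_assoc, ← Complex.exp_add]
  congr 2; push_cast; ring

theorem norm_sliceInv_le {H : ℝ × ℝ → ℂ} (t ξ : ℝ) :
    ‖sliceInv t H ξ‖ ≤ ∫ τ : ℝ, ‖H (τ, ξ)‖ := by
  refine (norm_integral_le_integral_norm _).trans_eq (integral_congr_ae (.of_forall fun τ => ?_))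
  simp only [norm_mul]
  rw [Complex.norm_exp]; simp

end Slice

section LittlewoodPaley

theorem continuous_psiLP (φ : 𝓢(ℝ, ℂ)) (m : ℕ) : Continuous (psiLP φ m) := by
  have h : Continuous (FT φ) := continuous_fourier_of_integrable φ.integrable
  cases m with
  | zero => exact h
  | succ n => simp only [psiLP]; fun_prop

theorem exists_bound_FT (φ : 𝓢(ℝ, ℂ)) :
    ∃ B : ℝ, 1 ≤ B ∧ (∀ ξ, ‖FT φ ξ‖ ≤ B) ∧ ∀ ξ η, ‖FT φ ξ - FT φ η‖ ≤ B * |ξ - η| := by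
  let f : 𝓢(ℝ, ℂ) := 𝓕 φ
  have h : FT φ = f := (SchwartzMap.fourier_coe φ).symm
  obtain ⟨A, hA⟩ : ∃ A : ℝ, ∀ ξ, ‖f ξ‖ ≤ A := ⟨_, norm_le_seminorm ℝ f⟩
  obtain ⟨D, hD⟩ : ∃ D : ℝ, ∀ ξ, ‖deriv f ξ‖ ≤ D :=
    ⟨_, fun ξ => norm_le_seminorm ℝ (derivCLM ℝ ℂ f) ξ⟩
  refine ⟨max 1 (max A D), le_max_left _ _, fun ξ => ?_, fun ξ η => ?_⟩
  · rw [h]; exact (hA ξ).trans ((le_max_left _ _).trans (le_max_right _ _))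
  · rw [h]
    have := Convex.norm_image_sub_le_of_norm_deriv_le (s := Set.univ) (C := D) (x := η) (y := ξ)
      (fun x _ => f.differentiableAt) (fun x _ => hD x) convex_univ trivial trivial
    refine this.trans ?_
    rw [Real.norm_eq_abs]
    gcongr
    exact (le_max_right _ _).trans (le_max_right _ _)

variable {φ : 𝓢(ℝ, ℂ)}

theorem psiLP_succ (φ : 𝓢(ℝ, ℂ)) (n : ℕ) (ξ : ℝ) :
    psiLP φ (n + 1) ξ = FT φ (((2 : ℝ) ^ (n + 1))⁻¹ * ξ) - FT φ (((2 : ℝ) ^ n)⁻¹ * ξ) := by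
  simp only [psiLP]
  rw [Real.rpow_neg (by norm_num), Real.rpow_neg (by norm_num), Real.rpow_natCast]
  norm_cast

theorem psiLP_eq_zero_of_ge (hφ : IsLPfilter φ) {m : ℕ} {ξ : ℝ} (h : 2 * 2 ^ m ≤ |ξ|) :
    psiLP φ m ξ = 0 := by
  cases m with
  | zero => exact hφ.2 ξ (by simpa using h)
  | succ n =>
    rw [psiLP_succ, hφ.2, hφ.2, sub_zero]
    · rw [abs_mul, abs_of_pos (by positivity : (0 : ℝ) < (2 ^ n)⁻¹), inv_mul_eq_div,
        le_div_iff₀ (by positivity)]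
      refine le_trans ?_ h
      rw [pow_succ]; nlinarith [pow_pos (two_pos : (0 : ℝ) < 2) n]
    · rwa [abs_mul, abs_of_pos (by positivity : (0 : ℝ) < (2 ^ (n + 1))⁻¹), inv_mul_eq_div,
        le_div_iff₀ (by positivity)]

theorem psiLP_eq_zero_of_le (hφ : IsLPfilter φ) {n : ℕ} {ξ : ℝ} (h : |ξ| ≤ 2 ^ n) :
    psiLP φ (n + 1) ξ = 0 := by
  rw [psiLP_succ, hφ.1, hφ.1, sub_self]
  · rw [abs_mul, abs_of_pos (by positivity : (0 : ℝ) < (2 ^ n)⁻¹), inv_mul_eq_div,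
      div_le_iff₀ (by positivity)]
    linarith
  · rw [abs_mul, abs_of_pos (by positivity : (0 : ℝ) < (2 ^ (n + 1))⁻¹), inv_mul_eq_div,
        div_le_iff₀ (by positivity)]
    refine h.trans ?_
    rw [pow_succ]; nlinarith [pow_pos (two_pos : (0 : ℝ) < 2) n]

theorem norm_psiLP_le {B : ℝ} (hB1 : 1 ≤ B) (hB : ∀ ξ, ‖FT φ ξ‖ ≤ B) (m : ℕ) (ξ : ℝ) :
    ‖psiLP φ m ξ‖ ≤ 2 * B := by
  cases m with
  | zero => exact (hB ξ).trans (by linarith)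
  | succ n =>
    rw [psiLP_succ]
    exact (norm_sub_le _ _).trans (by linarith [hB (((2 : ℝ) ^ (n + 1))⁻¹ * ξ), hB (((2 : ℝ) ^ n)⁻¹ * ξ)])

theorem norm_psiLP_le_mul_abs (hφ : IsLPfilter φ) {B : ℝ} (hB1 : 1 ≤ B)
    (hB : ∀ ξ, ‖FT φ ξ‖ ≤ B) (n : ℕ) (ξ : ℝ) :
    ‖psiLP φ (n + 1) ξ‖ ≤ 2 * B * (2⁻¹) ^ n * |ξ| := by
  rcases le_total |ξ| (2 ^ n) with h | h
  · rw [psiLP_eq_zero_of_le hφ h, norm_zero]; positivity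
  · refine (norm_psiLP_le hB1 hB _ _).trans ?_
    rw [mul_assoc]
    refine le_mul_of_one_le_right (by positivity) ?_
    rw [inv_pow, inv_mul_eq_div, le_div_iff₀ (by positivity)]
    linarith

theorem sum_psiLP (φ : 𝓢(ℝ, ℂ)) (n : ℕ) (ξ : ℝ) :
    ∑ m ∈ Finset.range (n + 1), psiLP φ m ξ = FT φ (((2 : ℝ) ^ n)⁻¹ * ξ) := by
  induction n with
  | zero => simp [psiLP]
  | succ n ih => rw [Finset.sum_range_succ, ih, psiLP_succ]; ring

theorem hasSum_psiLP (hφ : IsLPfilter φ) (ξ : ℝ) : HasSum (fun m => psiLP φ m ξ) 1 := by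
  obtain ⟨n, hn⟩ := pow_unbounded_of_one_lt |ξ| (one_lt_two : (1 : ℝ) < 2)
  have h1 : ∑ m ∈ Finset.range (n + 1), psiLP φ m ξ = 1 := by
    rw [sum_psiLP, hφ.1]
    rw [abs_mul, abs_of_pos (by positivity : (0 : ℝ) < (2 ^ n)⁻¹), inv_mul_eq_div,
      div_le_iff₀ (by positivity)]
    linarith
  rw [← h1]
  refine hasSum_sum_of_ne_finset_zero fun m hm => ?_
  obtain ⟨k, rfl⟩ : ∃ k, m = k + 1 := ⟨m - 1, by simp at hm; omega⟩
  refine psiLP_eq_zero_of_le hφ (hn.le.trans ?_)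
  simp only [Finset.mem_range, not_lt] at hm
  exact pow_le_pow_right₀ one_le_two (by omega)

end LittlewoodPaley

section Decay

theorem exists_schwartz_decay (W : 𝓢(ℝ × ℝ, ℂ)) :
    ∃ C : ℝ, 0 ≤ C ∧ ∀ τ ξ, ‖W (τ, ξ)‖ ≤ C * ((1 + τ ^ 2)⁻¹ * ((1 + ξ ^ 2)⁻¹ * (1 + ξ ^ 2)⁻¹)) := by
  obtain ⟨C, hC⟩ : ∃ C : ℝ, ∀ q, (1 + ‖q‖) ^ 6 * ‖W q‖ ≤ C :=
    ⟨_, fun q => by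
      simpa using! one_add_le_sup_seminorm_apply (𝕜 := ℝ) (m := (6, 0)) le_rfl le_rfl W q⟩
  have hC0 : 0 ≤ C := le_trans (by positivity) (hC 0)
  refine ⟨C, hC0, fun τ ξ => ?_⟩
  have h := hC (τ, ξ)
  have h1 : ∀ x : ℝ, |x| ≤ ‖(τ, ξ)‖ → 1 + x ^ 2 ≤ (1 + ‖(τ, ξ)‖) ^ 2 := fun x hx => by
    nlinarith [abs_nonneg x, sq_abs x]
  have hτ := h1 τ (by rw [Prod.norm_def]; exact le_max_left _ _)
  have hξ := h1 ξ (by rw [Prod.norm_def]; exact le_max_right _ _)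
  have h2 : (1 + τ ^ 2) * ((1 + ξ ^ 2) * (1 + ξ ^ 2)) ≤ (1 + ‖(τ, ξ)‖) ^ 6 :=
    calc _ ≤ (1 + ‖(τ, ξ)‖) ^ 2 * ((1 + ‖(τ, ξ)‖) ^ 2 * (1 + ‖(τ, ξ)‖) ^ 2) := by gcongr
      _ = _ := by ring
  rw [← mul_inv, ← mul_inv, ← div_eq_mul_inv, le_div_iff₀ (by positivity), mul_comm]
  exact (mul_le_mul_of_nonneg_right h2 (norm_nonneg _)).trans h

theorem integrable_schwartz_slice (W : 𝓢(ℝ × ℝ, ℂ)) (t : ℝ) : Integrable fun x => W (t, x) := by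
  obtain ⟨C, hC0, hC⟩ := exists_schwartz_decay W
  refine (integrable_inv_one_add_sq.const_mul C).mono' (by
    exact (W.continuous.comp (by fun_prop)).aestronglyMeasurable) (.of_forall fun x => ?_)
  refine (hC t x).trans ?_
  have h1 : (1 + t ^ 2)⁻¹ ≤ 1 := inv_le_one_of_one_le₀ (by nlinarith [sq_nonneg t])
  have h2 : (1 + x ^ 2)⁻¹ ≤ 1 := inv_le_one_of_one_le₀ (by nlinarith [sq_nonneg x])
  gcongr
  calc (1 + t ^ 2)⁻¹ * ((1 + x ^ 2)⁻¹ * (1 + x ^ 2)⁻¹) ≤ 1 * (1 * (1 + x ^ 2)⁻¹) := by gcongr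
    _ = _ := by ring

theorem exists_sliceInv_decay (W : 𝓢(ℝ × ℝ, ℂ)) :
    ∃ C : ℝ, 0 ≤ C ∧ ∀ t ξ, ‖sliceInv t W ξ‖ ≤ C * ((1 + ξ ^ 2)⁻¹ * (1 + ξ ^ 2)⁻¹) := by
  obtain ⟨C, hC0, hC⟩ := exists_schwartz_decay W
  refine ⟨C * Real.pi, by positivity, fun t ξ => (norm_sliceInv_le t ξ).trans ?_⟩
  calc ∫ τ, ‖W (τ, ξ)‖ ≤ ∫ τ : ℝ, (C * ((1 + ξ ^ 2)⁻¹ * (1 + ξ ^ 2)⁻¹)) * (1 + τ ^ 2)⁻¹ :=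
        integral_mono_of_nonneg (.of_forall fun τ => norm_nonneg _)
          (integrable_inv_one_add_sq.const_mul _) (.of_forall fun τ => (hC τ ξ).trans_eq (by ring))
    _ = _ := by rw [integral_const_mul, integral_univ_inv_one_add_sq]; ring

theorem integrable_snd_mul_schwartz (W : 𝓢(ℝ × ℝ, ℂ)) :
    Integrable fun q : ℝ × ℝ => |q.2| * ‖W q‖ := by
  obtain ⟨C, hC0, hC⟩ := exists_schwartz_decay W
  refine ((integrable_inv_one_add_sq.mul_prod integrable_inv_one_add_sq).const_mul C).mono'
    (by have := W.continuous; exact Continuous.aestronglyMeasurable (by fun_prop))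
    (.of_forall fun q => ?_)
  rw [Real.norm_of_nonneg (by positivity)]
  have h1 : |q.2| * (1 + q.2 ^ 2)⁻¹ ≤ 1 := by
    rw [← div_eq_mul_inv, div_le_one (by positivity)]
    nlinarith [sq_abs q.2, sq_nonneg (|q.2| - 1)]
  calc |q.2| * ‖W q‖ ≤ |q.2| * (C * ((1 + q.1 ^ 2)⁻¹ * ((1 + q.2 ^ 2)⁻¹ * (1 + q.2 ^ 2)⁻¹))) := by
        gcongr; exact hC q.1 q.2
    _ = (|q.2| * (1 + q.2 ^ 2)⁻¹) * (C * ((1 + q.1 ^ 2)⁻¹ * (1 + q.2 ^ 2)⁻¹)) := by ring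
    _ ≤ _ := mul_le_of_le_one_left (by positivity) h1

theorem memLp_inv_one_add_sq : MemLp (fun ξ : ℝ => (1 + ξ ^ 2)⁻¹) 2 volume := by
  have hc : Continuous fun ξ : ℝ => (1 + ξ ^ 2)⁻¹ :=
    Continuous.inv₀ (by fun_prop) fun ξ => by positivity
  rw [memLp_two_iff_integrable_sq hc.aestronglyMeasurable]
  refine integrable_inv_one_add_sq.mono' (by fun_prop) (.of_forall fun ξ => ?_)
  have h2 : (1 + ξ ^ 2)⁻¹ ≤ 1 := inv_le_one_of_one_le₀ (by nlinarith [sq_nonneg ξ])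
  have h3 : 0 ≤ (1 + ξ ^ 2)⁻¹ := by positivity
  rw [Real.norm_of_nonneg (by positivity)]
  nlinarith

end Decay

section Multipliers

/-- The indicator multiplier of the half line `0 ≤ ε ξ`. -/
def halfInd (ε ξ : ℝ) : ℂ := if 0 ≤ ε * ξ then 1 else 0

theorem measurable_halfInd (ε : ℝ) : Measurable (halfInd ε) :=
  Measurable.ite (measurableSet_le measurable_const (by fun_prop)) measurable_const measurable_const

theorem norm_halfInd_le (ε ξ : ℝ) : ‖halfInd ε ξ‖ ≤ 1 := by
  unfold halfInd; split_ifs <;> simp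

theorem integrable_multiplier {H : ℝ × ℝ → ℂ} (hH : Integrable H) {m : ℝ → ℂ} {c : ℝ}
    (hm : Measurable m) (hc : ∀ ξ, ‖m ξ‖ ≤ c) : Integrable fun q : ℝ × ℝ => m q.2 * H q :=
  hH.bdd_mul (c := c) (hm.comp measurable_snd).aestronglyMeasurable (.of_forall fun q => hc q.2)

theorem Pproj_eq_FT2inv {f : ℝ × ℝ → ℂ} {W : ℝ × ℝ → ℂ} (hW : Integrable W)
    (hf : FT2inv W = f) (hfi : ∀ t, Integrable fun x => f (t, x)) (ε : ℝ) :
    Pproj ε f = FT2inv fun q => halfInd ε q.2 * W q := by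
  ext ⟨t, x⟩
  rw [FT2inv_eq_FTinv_sliceInv
    (integrable_multiplier hW (measurable_halfInd ε) (norm_halfInd_le ε)), sliceInv_mul]
  have h1 : (fun x => f (t, x)) = 𝓕⁻ (sliceInv t W) := by
    ext x; rw [← hf, FT2inv_eq_FTinv_sliceInv hW, FTinv]
  have h2 := fourier_fourierInv_ae_eq (integrable_sliceInv hW t) (h1 ▸ hfi t)
  rw [← h1] at h2
  unfold Pproj FTinv FT
  refine Real.fourierInv_congr_ae ?_ x
  filter_upwards [h2] with ξ hξ
  rw [hξ, halfInd]

theorem FTinv_translate_dilate (φ : 𝓢(ℝ, ℂ)) (j : ℕ) (x η : ℝ) :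
    𝓕⁻ (fun y : ℝ => (((2 : ℝ) ^ j : ℝ) : ℂ) * φ ((2 : ℝ) ^ j * (x - y))) η =
      Complex.exp ((2 * Real.pi * Complex.I) * ((x * η : ℝ) : ℂ)) *
        FT φ (((2 : ℝ) ^ j)⁻¹ * η) := by
  have h0 := FTinv_apply (fun y : ℝ => (((2 : ℝ) ^ j : ℝ) : ℂ) * φ ((2 : ℝ) ^ j * (x - y))) η
  rw [FTinv] at h0
  rw [h0, ← integral_sub_left_eq_self _ _ x]
  have h2 := Measure.integral_comp_mul_left (fun z : ℝ =>
    Complex.exp (-(2 * Real.pi * Complex.I) * ((((2 : ℝ) ^ j)⁻¹ * η * z : ℝ) : ℂ)) * φ z)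
    ((2 : ℝ) ^ j)
  have h3 : FT φ (((2 : ℝ) ^ j)⁻¹ * η) = ∫ z : ℝ,
      Complex.exp (-(2 * Real.pi * Complex.I) * ((((2 : ℝ) ^ j)⁻¹ * η * z : ℝ) : ℂ)) * φ z := by
    rw [FT, Real.fourier_eq']
    refine integral_congr_ae (.of_forall fun z => ?_)
    simp only [smul_eq_mul]
    congr 2
    simp only [RCLike.inner_apply, conj_trivial]
    push_cast; ring
  have h4 : (∫ z : ℝ,
      Complex.exp (-(2 * Real.pi * Complex.I) * ((((2 : ℝ) ^ j)⁻¹ * η * z : ℝ) : ℂ)) * φ z) =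
      (((2 : ℝ) ^ j : ℝ) : ℂ) * ∫ z : ℝ, Complex.exp (-(2 * Real.pi * Complex.I) *
        ((((2 : ℝ) ^ j)⁻¹ * η * ((2 : ℝ) ^ j * z) : ℝ) : ℂ)) * φ ((2 : ℝ) ^ j * z) := by
    rw [h2, abs_of_pos (by positivity), Complex.real_smul, ← mul_assoc, ← Complex.ofReal_mul,
      mul_inv_cancel₀ (by positivity), Complex.ofReal_one, one_mul]
  rw [h3, h4, ← integral_const_mul, ← integral_const_mul]
  refine integral_congr_ae (.of_forall fun z => ?_)
  simp only [sub_sub_cancel]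
  have h5 : ((2 : ℝ) ^ j)⁻¹ * η * ((2 : ℝ) ^ j * z) = η * z := by
    field_simp
  rw [h5]
  have h6 : Complex.exp (2 * Real.pi * Complex.I * ((η * (x - z) : ℝ) : ℂ)) =
      Complex.exp ((2 * Real.pi * Complex.I) * ((x * η : ℝ) : ℂ)) *
      Complex.exp (-(2 * Real.pi * Complex.I) * ((η * z : ℝ) : ℂ)) := by
    rw [← Complex.exp_add]; congr 1; push_cast; ring
  rw [h6]; ring

theorem LPS_FTinv (φ : 𝓢(ℝ, ℂ)) (j : ℕ) {b : ℝ → ℂ} (hb : Integrable b) (x : ℝ) :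
    LPS φ j (FTinv b) x = FTinv (fun ξ => FT φ (((2 : ℝ) ^ j)⁻¹ * ξ) * b ξ) x := by
  have hg : Integrable fun y : ℝ => (((2 : ℝ) ^ j : ℝ) : ℂ) * φ ((2 : ℝ) ^ j * (x - y)) := by
    refine Integrable.const_mul ?_ _
    exact (φ.integrable.comp_mul_left' (by positivity : (2 : ℝ) ^ j ≠ 0)).comp_sub_left x
  have h := integral_fourierInv_mul_eq_flip hb hg
  unfold LPS
  rw [FTinv_apply]
  refine Eq.trans (integral_congr_ae (.of_forall fun y => ?_)) (h.trans
    (integral_congr_ae (.of_forall fun η => ?_)))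
  · simp only [FTinv]; ring
  · simp only [FTinv_translate_dilate]; ring

theorem Sx_FT2inv (φ : 𝓢(ℝ, ℂ)) (j : ℕ) {H : ℝ × ℝ → ℂ} (hH : Integrable H) :
    Sx φ j (FT2inv H) = FT2inv fun q => FT φ (((2 : ℝ) ^ j)⁻¹ * q.2) * H q := by
  obtain ⟨B, -, hB, -⟩ := exists_bound_FT φ
  have hc : Continuous (FT φ) := continuous_fourier_of_integrable φ.integrable
  ext ⟨t, x⟩
  rw [FT2inv_eq_FTinv_sliceInv (integrable_multiplier (m := fun ξ => FT φ (((2 : ℝ) ^ j)⁻¹ * ξ))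
    hH (by fun_prop) (fun ξ => hB _)), sliceInv_mul (fun ξ => FT φ (((2 : ℝ) ^ j)⁻¹ * ξ)),
    ← LPS_FTinv φ j (integrable_sliceInv hH t)]
  unfold Sx
  congr 1; ext y
  exact FT2inv_eq_FTinv_sliceInv hH t y

theorem FT2inv_sub {F G : ℝ × ℝ → ℂ} (hF : Integrable F) (hG : Integrable G) (p : ℝ × ℝ) :
    FT2inv F p - FT2inv G p = FT2inv (fun q => F q - G q) p := by
  have h : ∀ {F : ℝ × ℝ → ℂ}, Integrable F → Integrable fun q : ℝ × ℝ => planeChar p q * F q :=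
    fun hF => hF.bdd_mul (c := 1) (continuous_planeChar _).aestronglyMeasurable
      (.of_forall fun z => (norm_planeChar _ _).le)
  change (∫ q, planeChar p q * F q) - (∫ q, planeChar p q * G q) = ∫ q, planeChar p q * _
  rw [← integral_sub (h hF) (h hG)]
  simp only [mul_sub]

theorem FT2inv_add {F G : ℝ × ℝ → ℂ} (hF : Integrable F) (hG : Integrable G) (p : ℝ × ℝ) :
    FT2inv F p + FT2inv G p = FT2inv (fun q => F q + G q) p := by
  have h : ∀ {F : ℝ × ℝ → ℂ}, Integrable F → Integrable fun q : ℝ × ℝ => planeChar p q * F q :=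
    fun hF => hF.bdd_mul (c := 1) (continuous_planeChar _).aestronglyMeasurable
      (.of_forall fun z => (norm_planeChar _ _).le)
  change (∫ q, planeChar p q * F q) + (∫ q, planeChar p q * G q) = ∫ q, planeChar p q * _
  rw [← integral_add (h hF) (h hG)]
  simp only [mul_add]

theorem Dx_FT2inv (φ : 𝓢(ℝ, ℂ)) (j : ℕ) {H : ℝ × ℝ → ℂ} (hH : Integrable H) :
    Dx φ j (FT2inv H) = FT2inv fun q => psiLP φ (j + 1) q.2 * H q := by
  obtain ⟨B, -, hB, -⟩ := exists_bound_FT φ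
  have hc : Continuous (FT φ) := continuous_fourier_of_integrable φ.integrable
  have h (j : ℕ) := integrable_multiplier (m := fun ξ => FT φ (((2 : ℝ) ^ j)⁻¹ * ξ))
    hH (by fun_prop) (fun ξ => hB _)
  ext p
  rw [Dx, Sx_FT2inv φ _ hH, Sx_FT2inv φ _ hH, FT2inv_sub (h _) (h _)]
  simp only [psiLP_succ, sub_mul]

end Multipliers

section Paraproduct

/-- The Fourier-side kernel of the paraproduct with its frequency projections. -/
def paraKernel (φ : 𝓢(ℝ, ℂ)) (ε : ℝ) (U V : ℝ × ℝ → ℂ) (z : (ℝ × ℝ) × (ℝ × ℝ)) : ℂ :=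
  ∑' i : ℕ, (psiLP φ (i + 2) z.1.2 * (halfInd 1 z.1.2 * U z.1)) *
    (FT φ (((2 : ℝ) ^ i)⁻¹ * z.2.2) * (halfInd ε z.2.2 * V z.2))

variable {φ : 𝓢(ℝ, ℂ)}

theorem paraKernel_eq_zero (hφ : IsLPfilter φ) (ε : ℝ) (U V : ℝ × ℝ → ℂ)
    {z : (ℝ × ℝ) × (ℝ × ℝ)} (h : z.1.2 + z.2.2 ≤ 0) : paraKernel φ ε U V z = 0 := by
  unfold paraKernel
  refine (tsum_congr fun i => ?_).trans tsum_zero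
  by_cases h1 : 0 ≤ z.1.2
  · rcases le_or_gt z.1.2 (2 ^ (i + 1)) with h2 | h2
    · rw [psiLP_eq_zero_of_le hφ (by rwa [abs_of_nonneg h1])]; ring
    · rw [hφ.2 (((2 : ℝ) ^ i)⁻¹ * z.2.2), zero_mul, mul_zero]
      rw [abs_mul, abs_of_pos (by positivity : (0 : ℝ) < (2 ^ i)⁻¹), inv_mul_eq_div,
        le_div_iff₀ (by positivity), abs_of_neg (by
          have : (0 : ℝ) < 2 ^ (i + 1) := by positivity
          linarith)]
      rw [pow_succ] at h2
      linarith
  · simp [halfInd, h1]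

theorem tsum_geom_ne_top {a : ℕ → ℝ≥0∞} {C : ℝ≥0∞} (hC : C ≠ ∞)
    (h : ∀ i, a i ≤ C * 2⁻¹ ^ i) : ∑' i, a i ≠ ∞ := by
  refine ((ENNReal.tsum_le_tsum h).trans_lt ?_).ne
  rw [ENNReal.tsum_mul_left, ENNReal.tsum_geometric]
  refine ENNReal.mul_lt_top hC.lt_top ?_
  norm_num

theorem sum_lintegral_ne_top (hφ : IsLPfilter φ) (ε : ℝ) (U V : 𝓢(ℝ × ℝ, ℂ)) :
    ∑' i : ℕ, (∫⁻ r : ℝ × ℝ, ‖psiLP φ (i + 2) r.2 * (halfInd 1 r.2 * U r)‖ₑ) *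
      ∫⁻ r : ℝ × ℝ, ‖FT φ (((2 : ℝ) ^ i)⁻¹ * r.2) * (halfInd ε r.2 * V r)‖ₑ ≠ ∞ := by
  obtain ⟨B, hB1, hB, -⟩ := exists_bound_FT φ
  have hU := (integrable_snd_mul_schwartz U).2
  have hV : ∫⁻ r, ‖V r‖ₑ < ∞ := (V.integrable (μ := volume)).2
  refine tsum_geom_ne_top (C := (ENNReal.ofReal (2 * B) * ∫⁻ r : ℝ × ℝ, ‖|r.2| * ‖U r‖‖ₑ) *
    (ENNReal.ofReal B * ∫⁻ r, ‖V r‖ₑ)) ?_ fun i => ?_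
  · exact (ENNReal.mul_lt_top (ENNReal.mul_lt_top ENNReal.ofReal_lt_top hU)
      (ENNReal.mul_lt_top ENNReal.ofReal_lt_top hV)).ne
  · have h1 : ∫⁻ r : ℝ × ℝ, ‖psiLP φ (i + 2) r.2 * (halfInd 1 r.2 * U r)‖ₑ ≤
        (ENNReal.ofReal (2 * B) * 2⁻¹ ^ i) * ∫⁻ r : ℝ × ℝ, ‖|r.2| * ‖U r‖‖ₑ := by
      rw [← lintegral_const_mul' _ _ (by finiteness)]
      refine lintegral_mono fun r => ?_
      have h2 : (2⁻¹ : ℝ≥0∞) ^ i = ENNReal.ofReal (2⁻¹ ^ i) := by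
        rw [ENNReal.ofReal_pow (by norm_num), ENNReal.ofReal_inv_of_pos (by norm_num)]; simp
      rw [h2, ← ofReal_norm, ← ofReal_norm, ← ENNReal.ofReal_mul (by positivity),
        ← ENNReal.ofReal_mul (by positivity)]
      refine ENNReal.ofReal_le_ofReal ?_
      rw [norm_mul, norm_mul, norm_mul, norm_norm, Real.norm_eq_abs, abs_abs]
      have h3 := norm_psiLP_le_mul_abs hφ hB1 hB (i + 1) r.2
      have h4 : (2⁻¹ : ℝ) ^ (i + 1) ≤ 2⁻¹ ^ i :=
        pow_le_pow_of_le_one (by norm_num) (by norm_num) (by omega)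
      have h5 := norm_halfInd_le 1 r.2
      calc _ ≤ (2 * B * 2⁻¹ ^ (i + 1) * |r.2|) * (1 * ‖U r‖) := by gcongr
        _ ≤ (2 * B * 2⁻¹ ^ i * |r.2|) * (1 * ‖U r‖) := by gcongr
        _ = _ := by ring
    have h2 : ∫⁻ r : ℝ × ℝ, ‖FT φ (((2 : ℝ) ^ i)⁻¹ * r.2) * (halfInd ε r.2 * V r)‖ₑ ≤
        ENNReal.ofReal B * ∫⁻ r, ‖V r‖ₑ := by
      rw [← lintegral_const_mul' _ _ (by finiteness)]
      refine lintegral_mono fun r => ?_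
      rw [← ofReal_norm, ← ofReal_norm, ← ENNReal.ofReal_mul (by positivity)]
      refine ENNReal.ofReal_le_ofReal ?_
      rw [norm_mul, norm_mul]
      have h5 := norm_halfInd_le ε r.2
      calc _ ≤ B * (1 * ‖V r‖) := by gcongr; exact hB _
        _ = _ := by ring
    refine (mul_le_mul' h1 h2).trans_eq ?_
    ring

theorem integrable_psi_mul (φ : 𝓢(ℝ, ℂ)) (m : ℕ) (ε : ℝ) (U : 𝓢(ℝ × ℝ, ℂ)) :
    Integrable fun q : ℝ × ℝ => psiLP φ m q.2 * (halfInd ε q.2 * U q) := by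
  obtain ⟨B, hB1, hB, -⟩ := exists_bound_FT φ
  exact integrable_multiplier (integrable_multiplier U.integrable (measurable_halfInd _)
    (norm_halfInd_le _)) (continuous_psiLP φ m).measurable (norm_psiLP_le hB1 hB m)

theorem integrable_low_mul (φ : 𝓢(ℝ, ℂ)) (i : ℕ) (ε : ℝ) (V : 𝓢(ℝ × ℝ, ℂ)) :
    Integrable fun q : ℝ × ℝ => FT φ (((2 : ℝ) ^ i)⁻¹ * q.2) * (halfInd ε q.2 * V q) := by
  obtain ⟨B, hB1, hB, -⟩ := exists_bound_FT φ
  have hc : Continuous (FT φ) := continuous_fourier_of_integrable φ.integrable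
  exact integrable_multiplier (m := fun ξ => FT φ (((2 : ℝ) ^ i)⁻¹ * ξ))
    (integrable_multiplier V.integrable (measurable_halfInd _)
    (norm_halfInd_le _)) (by fun_prop) (fun ξ => hB _)

theorem integrable_paraKernel (hφ : IsLPfilter φ) (ε : ℝ) (U V : 𝓢(ℝ × ℝ, ℂ)) :
    Integrable (paraKernel φ ε U V) :=
  integrable_tsum_mul (fun i => integrable_psi_mul φ (i + 2) 1 U)
    (fun i => integrable_low_mul φ i ε V) (sum_lintegral_ne_top hφ ε U V)

theorem paraT_term (φ : 𝓢(ℝ, ℂ)) (ε : ℝ) {u v U V : 𝓢(ℝ × ℝ, ℂ)} (hU : FT2inv U = u)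
    (hV : FT2inv V = v) (i : ℕ) (p : ℝ × ℝ) :
    Sx φ i (Pproj ε v) p * Dx φ (i + 1) (Pproj 1 u) p =
      FT2inv (fun q => psiLP φ (i + 2) q.2 * (halfInd 1 q.2 * U q)) p *
      FT2inv (fun q => FT φ (((2 : ℝ) ^ i)⁻¹ * q.2) * (halfInd ε q.2 * V q)) p := by
  rw [Pproj_eq_FT2inv V.integrable hV (integrable_schwartz_slice v),
    Pproj_eq_FT2inv U.integrable hU (integrable_schwartz_slice u),
    Sx_FT2inv φ i (integrable_multiplier V.integrable (measurable_halfInd _) (norm_halfInd_le _)),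
    Dx_FT2inv φ _ (integrable_multiplier U.integrable (measurable_halfInd _) (norm_halfInd_le _)),
    mul_comm]

theorem paraT_eq_FT2inv (hφ : IsLPfilter φ) (ε : ℝ) {u v U V : 𝓢(ℝ × ℝ, ℂ)}
    (hU : FT2inv U = u) (hV : FT2inv V = v) :
    paraT φ (Pproj ε v) (Pproj 1 u) =
      FT2inv fun q => ∫ r, paraKernel φ ε U V (r, q - r) := by
  ext p
  unfold paraT
  simp only [paraT_term φ ε hU hV]
  exact tsum_FT2inv_mul (fun i => integrable_psi_mul φ (i + 2) 1 U)
    (fun i => integrable_low_mul φ i ε V) (sum_lintegral_ne_top hφ ε U V) p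

theorem integrable_paraKernel_integral (hφ : IsLPfilter φ) (ε : ℝ) (U V : 𝓢(ℝ × ℝ, ℂ)) :
    Integrable fun q => ∫ r, paraKernel φ ε U V (r, q - r) :=
  (integrable_diag (integrable_paraKernel hφ ε U V)).integral_prod_right

theorem lintegral_enorm_mul_le_eLpNorm {f g : ℝ → ℂ} (hf : AEStronglyMeasurable f)
    (hg : AEStronglyMeasurable g) :
    ∫⁻ x, ‖f x * g x‖ₑ ≤ eLpNorm f 2 volume * eLpNorm g 2 volume := by
  have h := eLpNorm_smul_le_mul_eLpNorm (p := 2) (q := 2) (r := 1) hg hf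
  rw [eLpNorm_one_eq_lintegral_enorm] at h
  simpa [Pi.smul_apply', smul_eq_mul] using h

theorem eLpNorm_FTinv_sliceInv_le {W : 𝓢(ℝ × ℝ, ℂ)} {m : ℝ → ℂ} {c d : ℝ} (hm : Measurable m)
    (hc : ∀ ξ, ‖m ξ‖ ≤ c) (hd : 0 ≤ d)
    {C : ℝ} (hC : ∀ t ξ, ‖sliceInv t W ξ‖ ≤ C * ((1 + ξ ^ 2)⁻¹ * (1 + ξ ^ 2)⁻¹))
    (hmd : ∀ ξ, ‖m ξ‖ ≤ d * (1 + ξ ^ 2)) (t : ℝ) :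
    eLpNorm (FTinv fun ξ => m ξ * sliceInv t W ξ) 2 volume ≤
      ENNReal.ofReal (C * d) * eLpNorm (fun ξ : ℝ => (1 + ξ ^ 2)⁻¹) 2 volume := by
  have hi : Integrable fun ξ => m ξ * sliceInv t W ξ :=
    (integrable_sliceInv W.integrable t).bdd_mul hm.aestronglyMeasurable (.of_forall hc)
  have hb : ∀ ξ, ‖m ξ * sliceInv t W ξ‖ ≤ C * d * ‖(1 + ξ ^ 2)⁻¹‖ := fun ξ => by
    rw [norm_mul, Real.norm_of_nonneg (by positivity : 0 ≤ (1 + ξ ^ 2)⁻¹)]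
    calc _ ≤ (d * (1 + ξ ^ 2)) * (C * ((1 + ξ ^ 2)⁻¹ * (1 + ξ ^ 2)⁻¹)) := by
          gcongr
          · exact hmd ξ
          · exact hC t ξ
      _ = _ := by field_simp
  have h2 : MemLp (fun ξ => m ξ * sliceInv t W ξ) 2 volume :=
    memLp_inv_one_add_sq.of_le_mul hi.1 (.of_forall hb)
  rw [FTinv, eLpNorm_fourierInv_eq hi h2]
  exact eLpNorm_le_mul_eLpNorm_of_ae_le_mul (.of_forall hb) 2

theorem integrable_paraT_slice (hφ : IsLPfilter φ) (ε : ℝ) {u v U V : 𝓢(ℝ × ℝ, ℂ)}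
    (hU : FT2inv U = u) (hV : FT2inv V = v) (t : ℝ) :
    Integrable fun x => paraT φ (Pproj ε v) (Pproj 1 u) (t, x) := by
  obtain ⟨B, hB1, hB, -⟩ := exists_bound_FT φ
  have hc : Continuous (FT φ) := continuous_fourier_of_integrable φ.integrable
  obtain ⟨C, hC0, hC⟩ := exists_sliceInv_decay U
  obtain ⟨D, hD0, hD⟩ := exists_sliceInv_decay V
  unfold paraT
  simp only [paraT_term φ ε hU hV]
  set J := eLpNorm (fun ξ : ℝ => (1 + ξ ^ 2)⁻¹) 2 volume
  have hJ : J ≠ ∞ := memLp_inv_one_add_sq.2.ne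
  have e1 : ∀ i x, FT2inv (fun q => psiLP φ (i + 2) q.2 * (halfInd 1 q.2 * U q)) (t, x) =
      FTinv (fun ξ => (psiLP φ (i + 2) ξ * halfInd 1 ξ) * sliceInv t U ξ) x := fun i x => by
    rw [FT2inv_eq_FTinv_sliceInv (integrable_psi_mul φ _ _ U), sliceInv_mul, sliceInv_mul]
    simp only [mul_assoc]
  have e2 : ∀ i x, FT2inv (fun q => FT φ (((2 : ℝ) ^ i)⁻¹ * q.2) * (halfInd ε q.2 * V q)) (t, x) =
      FTinv (fun ξ => (FT φ (((2 : ℝ) ^ i)⁻¹ * ξ) * halfInd ε ξ) * sliceInv t V ξ) x :=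
    fun i x => by
    rw [FT2inv_eq_FTinv_sliceInv (integrable_low_mul φ _ _ V),
      sliceInv_mul fun ξ => FT φ (((2 : ℝ) ^ i)⁻¹ * ξ), sliceInv_mul]
    simp only [mul_assoc]
  have c1 : ∀ i, Continuous fun x =>
      FT2inv (fun q => psiLP φ (i + 2) q.2 * (halfInd 1 q.2 * U q)) (t, x) :=
    fun i => (continuous_FT2inv (integrable_psi_mul φ _ _ U)).comp (by fun_prop)
  have c2 : ∀ i, Continuous fun x =>
      FT2inv (fun q => FT φ (((2 : ℝ) ^ i)⁻¹ * q.2) * (halfInd ε q.2 * V q)) (t, x) :=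
    fun i => (continuous_FT2inv (integrable_low_mul φ _ _ V)).comp (by fun_prop)
  refine integrable_tsum_of_lintegral
    (fun i => ((c1 i).mul (c2 i)).aestronglyMeasurable) ?_
  refine tsum_geom_ne_top (C := ENNReal.ofReal (C * (2 * B)) * J * (ENNReal.ofReal (D * B) * J))
    (by finiteness) fun i => ?_
  refine (lintegral_enorm_mul_le_eLpNorm (c1 i).aestronglyMeasurable
    (c2 i).aestronglyMeasurable).trans ?_
  have hp : (0 : ℝ) < 2⁻¹ ^ i := by positivity
  have h1 : eLpNorm (fun x =>
      FT2inv (fun q => psiLP φ (i + 2) q.2 * (halfInd 1 q.2 * U q)) (t, x)) 2 volume ≤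
      ENNReal.ofReal (C * (2 * B * 2⁻¹ ^ i)) * J := by
    simp only [e1]
    refine eLpNorm_FTinv_sliceInv_le (c := 2 * B * 1)
      ((continuous_psiLP φ _).measurable.mul (measurable_halfInd 1)) (fun ξ => ?_) (by positivity)
      hC (fun ξ => ?_) t
    · rw [Pi.mul_apply, norm_mul]
      gcongr
      · exact norm_psiLP_le hB1 hB _ _
      · exact norm_halfInd_le _ _
    · rw [Pi.mul_apply, norm_mul]
      have h4 : (2⁻¹ : ℝ) ^ (i + 1) ≤ 2⁻¹ ^ i :=
        pow_le_pow_of_le_one (by norm_num) (by norm_num) (by omega)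
      calc _ ≤ (2 * B * 2⁻¹ ^ (i + 1) * |ξ|) * 1 := by
            gcongr
            · exact norm_psiLP_le_mul_abs hφ hB1 hB (i + 1) ξ
            · exact norm_halfInd_le _ _
        _ ≤ (2 * B * 2⁻¹ ^ i * (1 + ξ ^ 2)) * 1 := by
            gcongr; nlinarith [sq_abs ξ, sq_nonneg (|ξ| - 1)]
        _ = _ := by ring
  have h2 : eLpNorm (fun x =>
      FT2inv (fun q => FT φ (((2 : ℝ) ^ i)⁻¹ * q.2) * (halfInd ε q.2 * V q)) (t, x)) 2 volume ≤
      ENNReal.ofReal (D * B) * J := by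
    simp only [e2]
    have hle : ∀ ξ, ‖FT φ (((2 : ℝ) ^ i)⁻¹ * ξ) * halfInd ε ξ‖ ≤ B := fun ξ => by
      rw [norm_mul]
      calc _ ≤ B * 1 := by
            gcongr
            · exact hB _
            · exact norm_halfInd_le _ _
        _ = _ := by ring
    refine eLpNorm_FTinv_sliceInv_le (c := B)
      (Measurable.mul (by fun_prop) (measurable_halfInd ε)) hle (by positivity)
      hD (fun ξ => (hle ξ).trans ?_) t
    exact le_mul_of_one_le_right (by positivity) (by nlinarith [sq_nonneg ξ])
  refine (mul_le_mul' h1 h2).trans_eq ?_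
  have h5 : (2⁻¹ : ℝ≥0∞) ^ i = ENNReal.ofReal (2⁻¹ ^ i) := by
    rw [ENNReal.ofReal_pow (by norm_num), ENNReal.ofReal_inv_of_pos (by norm_num)]; simp
  rw [h5, ← mul_assoc C, ENNReal.ofReal_mul (by positivity)]
  ring

/-- The projected paraproduct is the inverse Fourier transform of an explicit function. -/
theorem Pproj_paraT_eq_FT2inv (hφ : IsLPfilter φ) (ε : ℝ) {u v U V : 𝓢(ℝ × ℝ, ℂ)}
    (hU : FT2inv U = u) (hV : FT2inv V = v) :
    Pproj 1 (paraT φ (Pproj ε v) (Pproj 1 u)) =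
      FT2inv fun q => ∫ r, paraKernel φ ε U V (r, q - r) := by
  rw [Pproj_eq_FT2inv (integrable_paraKernel_integral hφ ε U V) (paraT_eq_FT2inv hφ ε hU hV).symm
    (integrable_paraT_slice hφ ε hU hV)]
  congr 1; ext q
  by_cases h : 0 ≤ q.2
  · simp [halfInd, h]
  · have : ∀ r, paraKernel φ ε U V (r, q - r) = 0 := fun r =>
      paraKernel_eq_zero hφ ε U V (by simp; linarith)
    simp [this]

end Paraproduct

section Blocks

/-- The `L²` norm of a nonnegative function on the plane. -/
def l2 (f : ℝ × ℝ → ℝ≥0∞) : ℝ≥0∞ := (∫⁻ q, f q ^ (2 : ℝ)) ^ (1 / 2 : ℝ)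

theorem eLpNorm_eq_l2 (F : ℝ × ℝ → ℂ) : eLpNorm F 2 volume = l2 fun q => ‖F q‖ₑ := by
  rw [eLpNorm_eq_lintegral_rpow_enorm_toReal two_ne_zero ENNReal.ofNat_ne_top]
  simp [l2]

theorem l2_mono {f g : ℝ × ℝ → ℝ≥0∞} (h : ∀ q, f q ≤ g q) : l2 f ≤ l2 g := by
  unfold l2
  gcongr
  exact h _

theorem l2_mono_ae {f g : ℝ × ℝ → ℝ≥0∞} (h : ∀ᵐ q, f q ≤ g q) : l2 f ≤ l2 g := by
  unfold l2
  refine ENNReal.rpow_le_rpow (lintegral_mono_ae ?_) (by norm_num)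
  filter_upwards [h] with q hq
  gcongr

/-- The symbol of the space–time block `Δ^±_{jk}`. -/
def blockSymbol (φ : 𝓢(ℝ, ℂ)) (ε : ℝ) (m n : ℕ) (q : ℝ × ℝ) : ℂ :=
  halfInd ε q.2 * psiLP φ m q.2 * psiLP φ n (q.1 - ε * q.2 ^ 2)

variable {φ : 𝓢(ℝ, ℂ)}

theorem Xblock_eq (φ : 𝓢(ℝ, ℂ)) (ε : ℝ) (m n : ℕ) (w : ℝ × ℝ → ℂ) :
    Xblock φ ε m n w = FT2inv fun q => blockSymbol φ ε m n q * FT2 w q := rfl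

theorem hasCompactSupport_symbol (hφ : IsLPfilter φ) (ε : ℝ) (m n : ℕ) (F : ℝ × ℝ → ℂ) :
    HasCompactSupport fun q : ℝ × ℝ =>
      psiLP φ m q.2 * psiLP φ n (q.1 - ε * q.2 ^ 2) * F q := by
  refine HasCompactSupport.intro
    (K := Metric.closedBall (0 : ℝ) (2 * 2 ^ n + |ε| * (2 * 2 ^ m) ^ 2) ×ˢ
      Metric.closedBall (0 : ℝ) (2 * 2 ^ m))
    ((isCompact_closedBall _ _).prod (isCompact_closedBall _ _)) fun q hq => ?_
  by_cases h1 : 2 * 2 ^ m ≤ |q.2|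
  · rw [psiLP_eq_zero_of_ge hφ h1]; ring
  by_cases h2 : 2 * 2 ^ n ≤ |q.1 - ε * q.2 ^ 2|
  · rw [psiLP_eq_zero_of_ge hφ h2]; ring
  refine absurd ?_ hq
  simp only [Set.mem_prod, Metric.mem_closedBall, dist_zero_right, Real.norm_eq_abs]
  push Not at h1 h2
  refine ⟨?_, h1.le⟩
  have h3 : q.2 ^ 2 ≤ (2 * 2 ^ m) ^ 2 := by
    rw [← sq_abs]; gcongr
  calc |q.1| = |(q.1 - ε * q.2 ^ 2) + ε * q.2 ^ 2| := by ring_nf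
    _ ≤ |q.1 - ε * q.2 ^ 2| + |ε * q.2 ^ 2| := abs_add_le _ _
    _ ≤ _ := by rw [abs_mul, abs_of_nonneg (sq_nonneg q.2)]; gcongr

theorem integrable_memLp_symbol (hφ : IsLPfilter φ) (ε : ℝ) (m n : ℕ) {F : ℝ × ℝ → ℂ}
    (hF : Continuous F) : Integrable (fun q => blockSymbol φ ε m n q * F q) ∧
      MemLp (fun q => blockSymbol φ ε m n q * F q) 2 volume := by
  have hs := hasCompactSupport_symbol hφ ε m n F
  have hc : Continuous fun q : ℝ × ℝ =>
      psiLP φ m q.2 * psiLP φ n (q.1 - ε * q.2 ^ 2) * F q := by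
    have h1 := continuous_psiLP φ m
    have h2 := continuous_psiLP φ n
    fun_prop
  have h1 : Integrable fun q : ℝ × ℝ =>
      halfInd ε q.2 * (psiLP φ m q.2 * psiLP φ n (q.1 - ε * q.2 ^ 2) * F q) :=
    integrable_multiplier (hc.integrable_of_hasCompactSupport hs) (measurable_halfInd ε)
      (norm_halfInd_le ε)
  have h2 : MemLp (fun q : ℝ × ℝ =>
      halfInd ε q.2 * (psiLP φ m q.2 * psiLP φ n (q.1 - ε * q.2 ^ 2) * F q)) 2 volume := by
    refine (hc.memLp_of_hasCompactSupport hs).mono h1.1 (.of_forall fun q => ?_)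
    rw [norm_mul]
    exact mul_le_of_le_one_left (norm_nonneg _) (norm_halfInd_le _ _)
  have e : (fun q : ℝ × ℝ => blockSymbol φ ε m n q * F q) = fun q =>
      halfInd ε q.2 * (psiLP φ m q.2 * psiLP φ n (q.1 - ε * q.2 ^ 2) * F q) := by
    ext q; simp only [blockSymbol]; ring
  rw [e]
  exact ⟨h1, h2⟩

theorem continuous_FT2' (w : ℝ × ℝ → ℂ) : Continuous (FT2 w) := by
  by_cases h : Integrable w
  · exact continuous_FT2 h
  · rw [FT2_eq_zero_of_not_integrable h]; exact continuous_zero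

theorem eLpNorm_block (hφ : IsLPfilter φ) (m n : ℕ) (w : ℝ × ℝ → ℂ) :
    eLpNorm (fun p : ℝ × ℝ => Xblock φ 1 m n w p + Xblock φ (-1) m n w p) 2 volume =
      l2 fun q => ‖(blockSymbol φ 1 m n q + blockSymbol φ (-1) m n q) * FT2 w q‖ₑ := by
  have hc := continuous_FT2' w
  obtain ⟨h1, h2⟩ := integrable_memLp_symbol hφ 1 m n hc
  obtain ⟨h3, h4⟩ := integrable_memLp_symbol hφ (-1) m n hc
  have e : (fun p : ℝ × ℝ => Xblock φ 1 m n w p + Xblock φ (-1) m n w p) =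
      FT2inv fun q => blockSymbol φ 1 m n q * FT2 w q + blockSymbol φ (-1) m n q * FT2 w q := by
    ext p; rw [Xblock_eq, Xblock_eq, FT2inv_add h1 h3]
  rw [e]
  refine (eLpNorm_FT2inv (h1.add h3) (h2.add h4)).trans ?_
  rw [eLpNorm_eq_l2]
  simp only [Pi.add_apply, add_mul]

theorem l2_blockSymbol_le (hφ : IsLPfilter φ) {ε : ℝ} (hε : ε = 1 ∨ ε = -1) (m n : ℕ)
    (w : ℝ × ℝ → ℂ) :
    (l2 fun q => ‖blockSymbol φ ε m n q * FT2 w q‖ₑ) ≤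
      eLpNorm (fun p : ℝ × ℝ => Xblock φ 1 m n w p + Xblock φ (-1) m n w p) 2 volume := by
  rw [eLpNorm_block hφ]
  refine l2_mono_ae ?_
  have h0 : ∀ᵐ q : ℝ × ℝ, q.2 ≠ 0 := by
    rw [Measure.volume_eq_prod]
    have : ∀ᵐ x : ℝ, x ≠ 0 := Measure.ae_ne volume 0
    exact Measure.quasiMeasurePreserving_snd.ae this
  filter_upwards [h0] with q hq
  rw [← ofReal_norm, ← ofReal_norm]
  refine ENNReal.ofReal_le_ofReal ?_
  rw [norm_mul, norm_mul]
  refine mul_le_mul_of_nonneg_right ?_ (norm_nonneg _)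
  rcases lt_or_gt_of_ne hq with h | h
  · rcases hε with rfl | rfl
    · have : blockSymbol φ 1 m n q = 0 := by simp [blockSymbol, halfInd, h]
      rw [this, norm_zero]; exact norm_nonneg _
    · have : blockSymbol φ 1 m n q = 0 := by simp [blockSymbol, halfInd, h]
      rw [this, zero_add]
  · rcases hε with rfl | rfl
    · have : blockSymbol φ (-1) m n q = 0 := by simp [blockSymbol, halfInd, h]
      rw [this, add_zero]
    · have : blockSymbol φ (-1) m n q = 0 := by simp [blockSymbol, halfInd, h]
      rw [this, norm_zero]; exact norm_nonneg _

theorem eLpNorm_block_FT2inv_le (hφ : IsLPfilter φ) (m n : ℕ) {G : ℝ × ℝ → ℂ}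
    (hG : Integrable G) (hG0 : ∀ q : ℝ × ℝ, q.2 ≤ 0 → G q = 0) :
    eLpNorm (fun p : ℝ × ℝ => Xblock φ 1 m n (FT2inv G) p + Xblock φ (-1) m n (FT2inv G) p) 2
      volume ≤ l2 fun q => ‖blockSymbol φ 1 m n q * G q‖ₑ := by
  rw [eLpNorm_block hφ]
  refine l2_mono_ae ?_
  have h : ∀ᵐ q, ‖FT2 (FT2inv G) q‖ ≤ ‖G q‖ := by
    by_cases hi : Integrable (FT2inv G)
    · filter_upwards [FT2_FT2inv_ae_eq hG hi] with q hq
      rw [hq]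
    · rw [FT2_eq_zero_of_not_integrable hi]
      exact .of_forall fun q => by simp
  filter_upwards [h] with q hq
  rw [← ofReal_norm, ← ofReal_norm]
  refine ENNReal.ofReal_le_ofReal ?_
  rw [norm_mul, norm_mul]
  rcases le_or_gt q.2 0 with h1 | h1
  · rw [hG0 q h1, norm_zero] at hq ⊢
    rw [le_antisymm hq (norm_nonneg _)]; simp
  · have : blockSymbol φ (-1) m n q = 0 := by simp [blockSymbol, halfInd, h1]
    rw [this, add_zero]
    gcongr

end Blocks

section Geometry

theorem volume_le_of_strips {T : Set (ℝ × ℝ)} (hT : MeasurableSet T) {p r : ℝ → ℝ} {A B L : ℝ}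
    (hA : ∀ z ∈ T, |z.1 - p z.2| ≤ A) (hB : ∀ z ∈ T, |z.1 - r z.2| ≤ B)
    (hL : ∀ z ∈ T, ∀ z' ∈ T, |z.2 - z'.2| ≤ L) :
    volume T ≤ ENNReal.ofReal (2 * min A B) * ENNReal.ofReal L := by
  set J := Prod.snd '' T with hJ
  have h1 : volume J ≤ ENNReal.ofReal L := by
    refine (Real.volume_le_diam J).trans (Metric.ediam_le ?_)
    rintro _ ⟨z, hz, rfl⟩ _ ⟨z', hz', rfl⟩
    rw [edist_dist, Real.dist_eq]
    exact ENNReal.ofReal_le_ofReal (hL z hz z' hz')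
  rw [Measure.volume_eq_prod, Measure.prod_apply_symm hT]
  calc ∫⁻ y, volume ((fun x => (x, y)) ⁻¹' T)
      ≤ ∫⁻ y, (toMeasurable volume J).indicator (fun _ => ENNReal.ofReal (2 * min A B)) y := by
        refine lintegral_mono fun y => ?_
        by_cases hy : y ∈ J
        · rw [Set.indicator_of_mem (subset_toMeasurable _ _ hy)]
          have hs1 : (fun x => (x, y)) ⁻¹' T ⊆ Set.Icc (p y - A) (p y + A) := fun x hx => by
            have := abs_le.1 (hA _ hx)
            constructor <;> linarith [this.1, this.2]
          have hs2 : (fun x => (x, y)) ⁻¹' T ⊆ Set.Icc (r y - B) (r y + B) := fun x hx => by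
            have := abs_le.1 (hB _ hx)
            constructor <;> linarith [this.1, this.2]
          rcases le_total A B with h | h
          · rw [min_eq_left h]
            refine (measure_mono hs1).trans ?_
            rw [Real.volume_Icc]; ring_nf; rfl
          · rw [min_eq_right h]
            refine (measure_mono hs2).trans ?_
            rw [Real.volume_Icc]; ring_nf; rfl
        · have : (fun x => (x, y)) ⁻¹' T = ∅ := by
            ext x
            simp only [Set.mem_preimage, Set.mem_empty_iff_false, iff_false]
            exact fun hx => hy ⟨_, hx, rfl⟩
          rw [this]; simp
    _ = ENNReal.ofReal (2 * min A B) * volume J := by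
        rw [lintegral_indicator_const (measurableSet_toMeasurable _ _), measure_toMeasurable]
    _ ≤ _ := by gcongr

theorem volume_le_of_strips_linear {T : Set (ℝ × ℝ)} (hT : MeasurableSet T) {p r : ℝ → ℝ}
    {A B δ : ℝ} (hA0 : 0 ≤ A) (hB0 : 0 ≤ B) (hδ : 0 < δ)
    (hA : ∀ z ∈ T, |z.1 - p z.2| ≤ A) (hB : ∀ z ∈ T, |z.1 - r z.2| ≤ B)
    (hP : ∀ z ∈ T, ∀ z' ∈ T,
      δ * |z.2 - z'.2| ≤ |(p z.2 - r z.2) - (p z'.2 - r z'.2)|) :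
    volume T ≤ ENNReal.ofReal (8 * A * B / δ) := by
  refine (volume_le_of_strips hT hA hB (L := 2 * (A + B) / δ) fun z hz z' hz' => ?_).trans ?_
  · rw [le_div_iff₀ hδ, mul_comm]
    have h1 := abs_le.1 (hA z hz)
    have h2 := abs_le.1 (hB z hz)
    have h3 := abs_le.1 (hA z' hz')
    have h4 := abs_le.1 (hB z' hz')
    refine (hP z hz z' hz').trans (abs_le.2 ⟨?_, ?_⟩) <;>
      linarith [h1.1, h1.2, h2.1, h2.2, h3.1, h3.2, h4.1, h4.2]
  · rw [← ENNReal.ofReal_mul (by positivity)]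
    refine ENNReal.ofReal_le_ofReal ?_
    rw [mul_div_assoc', div_le_div_iff_of_pos_right hδ]
    rcases le_total A B with h | h
    · rw [min_eq_left h]; nlinarith
    · rw [min_eq_right h]; nlinarith

theorem volume_le_of_strips_quadratic {T : Set (ℝ × ℝ)} (hT : MeasurableSet T) {p r : ℝ → ℝ}
    {A B : ℝ} (hA0 : 0 ≤ A) (hB0 : 0 ≤ B)
    (hA : ∀ z ∈ T, |z.1 - p z.2| ≤ A) (hB : ∀ z ∈ T, |z.1 - r z.2| ≤ B)
    (hP : ∀ z ∈ T, ∀ z' ∈ T,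
      2 * |z.2 - z'.2| ^ 2 ≤ |(p z.2 - r z.2) - (p z'.2 - r z'.2)|) :
    volume T ≤ ENNReal.ofReal (4 * B * √A) := by
  refine (volume_le_of_strips hT hA hB (L := √(A + B)) fun z hz z' hz' => ?_).trans ?_
  · refine Real.le_sqrt_of_sq_le ?_
    have h1 := abs_le.1 (hA z hz)
    have h2 := abs_le.1 (hB z hz)
    have h3 := abs_le.1 (hA z' hz')
    have h4 := abs_le.1 (hB z' hz')
    have : |(p z.2 - r z.2) - (p z'.2 - r z'.2)| ≤ 2 * (A + B) := abs_le.2 ⟨by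
      linarith [h1.1, h1.2, h2.1, h2.2, h3.1, h3.2, h4.1, h4.2], by
      linarith [h1.1, h1.2, h2.1, h2.2, h3.1, h3.2, h4.1, h4.2]⟩
    linarith [hP z hz z' hz']
  · rw [← ENNReal.ofReal_mul (by positivity)]
    refine ENNReal.ofReal_le_ofReal ?_
    have key : min A B * √(A + B) ≤ 2 * B * √A := by
      obtain ⟨a, ha, rfl⟩ : ∃ a, 0 ≤ a ∧ A = a ^ 2 := ⟨√A, Real.sqrt_nonneg _, (Real.sq_sqrt hA0).symm⟩
      obtain ⟨b, hb, rfl⟩ : ∃ b, 0 ≤ b ∧ B = b ^ 2 := ⟨√B, Real.sqrt_nonneg _, (Real.sq_sqrt hB0).symm⟩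
      rw [Real.sqrt_sq ha]
      rcases le_total a b with h | h
      · have h5 : √(a ^ 2 + b ^ 2) ≤ 2 * b :=
          Real.sqrt_le_iff.2 ⟨by positivity, by nlinarith⟩
        calc _ ≤ a ^ 2 * (2 * b) := by gcongr; exact min_le_left _ _
          _ ≤ _ := by
            have : a * b * a ≤ a * b * b := by gcongr
            nlinarith
      · have h5 : √(a ^ 2 + b ^ 2) ≤ 2 * a :=
          Real.sqrt_le_iff.2 ⟨by positivity, by nlinarith⟩
        calc _ ≤ b ^ 2 * (2 * a) := by gcongr; exact min_le_right _ _
          _ = _ := by ring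
    linarith

/-- The frequency configurations of the paraproduct interaction: `z.1` and `z.2` are the
space-time frequencies of the high and the low factor, with spatial sizes `2 ^ m₁`, `2 ^ m₂`
and modulations `2 ^ n₁`, `2 ^ n₂`; the output has size `2 ^ m₀` and modulation `2 ^ n₀`. -/
def interactionSet (ε : ℝ) (m₀ n₀ m₁ n₁ m₂ n₂ : ℕ) : Set ((ℝ × ℝ) × (ℝ × ℝ)) :=
  {z | 2 ≤ z.1.2 ∧ |z.2.2| ≤ z.1.2 ∧ 0 < z.1.2 + z.2.2 ∧ 0 ≤ ε * z.2.2 ∧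
    (2 : ℝ) ^ m₁ ≤ 2 * z.1.2 ∧ z.1.2 ≤ 2 * 2 ^ m₁ ∧
    (m₂ ≠ 0 → (2 : ℝ) ^ m₂ ≤ 2 * |z.2.2|) ∧ |z.2.2| ≤ 2 * 2 ^ m₂ ∧
    (m₀ ≠ 0 → (2 : ℝ) ^ m₀ ≤ 2 * (z.1.2 + z.2.2)) ∧ z.1.2 + z.2.2 ≤ 2 * 2 ^ m₀ ∧
    |z.1.1 - z.1.2 ^ 2| ≤ 2 * 2 ^ n₁ ∧ |z.2.1 - ε * z.2.2 ^ 2| ≤ 2 * 2 ^ n₂ ∧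
    |z.1.1 + z.2.1 - (z.1.2 + z.2.2) ^ 2| ≤ 2 * 2 ^ n₀}

theorem measurableSet_interactionSet (ε : ℝ) (m₀ n₀ m₁ n₁ m₂ n₂ : ℕ) :
    MeasurableSet (interactionSet ε m₀ n₀ m₁ n₁ m₂ n₂) := by
  unfold interactionSet
  simp only [imp_iff_not_or, Set.ofPred_and, Set.ofPred_or]
  repeat' first | apply MeasurableSet.inter | apply MeasurableSet.union
  all_goals first
    | exact MeasurableSet.const _
    | exact measurableSet_le (by fun_prop) (by fun_prop)
    | exact measurableSet_lt (by fun_prop) (by fun_prop)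

/-- The size of the paraproduct symbol, restricted to a frequency configuration. -/
def interactionKernel (ε : ℝ) (m₀ n₀ m₁ n₁ m₂ n₂ : ℕ) : (ℝ × ℝ) × (ℝ × ℝ) → ℝ≥0∞ :=
  (interactionSet ε m₀ n₀ m₁ n₁ m₂ n₂).indicator fun z =>
    ENNReal.ofReal ((z.1.2 + z.2.2) / z.1.2)

theorem measurable_interactionKernel (ε : ℝ) (m₀ n₀ m₁ n₁ m₂ n₂ : ℕ) :
    Measurable (interactionKernel ε m₀ n₀ m₁ n₁ m₂ n₂) :=
  Measurable.indicator (by fun_prop) (measurableSet_interactionSet ..)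

theorem lintegral_interactionKernel_sq_le {ε : ℝ} {m₀ n₀ m₁ n₁ m₂ n₂ : ℕ}
    {f : ℝ × ℝ → (ℝ × ℝ) × (ℝ × ℝ)} (hf : Measurable f) {c a A : ℝ} (hc : 0 ≤ c)
    (hκ : ∀ q, f q ∈ interactionSet ε m₀ n₀ m₁ n₁ m₂ n₂ →
      ((f q).1.2 + (f q).2.2) / (f q).1.2 ≤ c)
    (hv : volume (f ⁻¹' interactionSet ε m₀ n₀ m₁ n₁ m₂ n₂) ≤ ENNReal.ofReal a)
    (hA : c ^ 2 * a ≤ A) :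
    ∫⁻ q, interactionKernel ε m₀ n₀ m₁ n₁ m₂ n₂ (f q) ^ (2 : ℝ) ≤ ENNReal.ofReal A := by
  calc ∫⁻ q, interactionKernel ε m₀ n₀ m₁ n₁ m₂ n₂ (f q) ^ (2 : ℝ)
      ≤ ∫⁻ q, (f ⁻¹' interactionSet ε m₀ n₀ m₁ n₁ m₂ n₂).indicator
          (fun _ => ENNReal.ofReal (c ^ 2)) q := by
        refine lintegral_mono fun q => ?_
        by_cases h : f q ∈ interactionSet ε m₀ n₀ m₁ n₁ m₂ n₂
        · rw [Set.indicator_of_mem (by exact h), interactionKernel, Set.indicator_of_mem h,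
            ENNReal.rpow_ofNat, ENNReal.ofReal_pow hc]
          gcongr
          exact hκ q h
        · simp [interactionKernel, h]
    _ = ENNReal.ofReal (c ^ 2) * volume (f ⁻¹' interactionSet ε m₀ n₀ m₁ n₁ m₂ n₂) :=
        lintegral_indicator_const (hf (measurableSet_interactionSet ..)) _
    _ ≤ ENNReal.ofReal (c ^ 2) * ENNReal.ofReal a := by gcongr
    _ ≤ ENNReal.ofReal A := by
        rw [← ENNReal.ofReal_mul (by positivity)]
        exact ENNReal.ofReal_le_ofReal hA

end Geometry

section KernelBounds

variable {ε : ℝ} {m₀ n₀ m₁ n₁ m₂ n₂ : ℕ}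

theorem symbol_le_two {z : (ℝ × ℝ) × (ℝ × ℝ)}
    (hz : z ∈ interactionSet ε m₀ n₀ m₁ n₁ m₂ n₂) : (z.1.2 + z.2.2) / z.1.2 ≤ 2 := by
  obtain ⟨h1, h2, -⟩ := hz
  rw [div_le_iff₀ (by linarith)]
  linarith [le_abs_self z.2.2]

theorem symbol_le_div {z : (ℝ × ℝ) × (ℝ × ℝ)}
    (hz : z ∈ interactionSet ε m₀ n₀ m₁ n₁ m₂ n₂) :
    (z.1.2 + z.2.2) / z.1.2 ≤ 2 * (z.1.2 + z.2.2) / 2 ^ m₁ := by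
  obtain ⟨h1, h2, h3, -, h4, -⟩ := hz
  rw [div_le_div_iff₀ (by linarith) (by positivity)]
  nlinarith

theorem symbol_le_ratio {z : (ℝ × ℝ) × (ℝ × ℝ)}
    (hz : z ∈ interactionSet ε m₀ n₀ m₁ n₁ m₂ n₂) :
    (z.1.2 + z.2.2) / z.1.2 ≤ 4 * (2 ^ m₀ / 2 ^ m₁) := by
  refine (symbol_le_div hz).trans ?_
  obtain ⟨-, -, -, -, -, -, -, -, -, h, -⟩ := hz
  rw [mul_div_assoc', div_le_div_iff_of_pos_right (by positivity)]
  linarith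

theorem low_le_of_mem {z : (ℝ × ℝ) × (ℝ × ℝ)}
    (hz : z ∈ interactionSet ε m₀ n₀ m₁ n₁ m₂ n₂) : (2 : ℝ) ^ m₂ ≤ 4 * 2 ^ m₁ := by
  obtain ⟨h1, h2, -, -, -, h3, h4, -⟩ := hz
  rcases eq_or_ne m₂ 0 with rfl | h
  · have : (1 : ℝ) ≤ 2 ^ m₁ := one_le_pow₀ (by norm_num)
    rw [pow_zero]; linarith
  · linarith [h4 h]

theorem out_le_of_mem {z : (ℝ × ℝ) × (ℝ × ℝ)}
    (hz : z ∈ interactionSet ε m₀ n₀ m₁ n₁ m₂ n₂) : (2 : ℝ) ^ m₀ ≤ 8 * 2 ^ m₁ := by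
  obtain ⟨h1, h2, -, -, -, h3, -, -, h4, -⟩ := hz
  rcases eq_or_ne m₀ 0 with rfl | h
  · have : (1 : ℝ) ≤ 2 ^ m₁ := one_le_pow₀ (by norm_num)
    rw [pow_zero]; linarith
  · linarith [h4 h, le_abs_self z.2.2]

theorem lintegral_kernel_output_le_of_transversal (h : 128 * (2 : ℝ) ^ m₂ ≤ 2 ^ m₁)
    (q : ℝ × ℝ) (hε : ε = 1 ∨ ε = -1) :
    ∫⁻ r, interactionKernel ε m₀ n₀ m₁ n₁ m₂ n₂ (r, q - r) ^ (2 : ℝ) ≤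
      ENNReal.ofReal (256 * (2 ^ n₁ * 2 ^ n₂) / 2 ^ m₁) := by
  have hf : Measurable fun r : ℝ × ℝ => (r, q - r) := by fun_prop
  refine lintegral_interactionKernel_sq_le hf zero_le_two (fun r hr => symbol_le_two hr)
    (volume_le_of_strips_linear (hf (measurableSet_interactionSet ..)) (p := fun x => x ^ 2)
      (r := fun x => q.1 - ε * (q.2 - x) ^ 2) (A := 2 * 2 ^ n₁) (B := 2 * 2 ^ n₂)
      (δ := 2 ^ m₁ / 2) (by positivity) (by positivity) (by positivity) ?_ ?_ ?_) ?_
  · rintro z ⟨-, -, -, -, -, -, -, -, -, -, h, -⟩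
    exact h
  · rintro z ⟨-, -, -, -, -, -, -, -, -, -, -, h, -⟩
    rw [abs_sub_comm]
    refine le_trans (le_of_eq ?_) h
    congr 1
    simp only [Prod.fst_sub, Prod.snd_sub]
    ring
  · rintro z ⟨-, -, -, -, h1, -, -, h2, -⟩ z' ⟨-, -, -, -, h1', -, -, h2', -⟩
    simp only [Prod.snd_sub] at h1 h2 h1' h2'
    have e : (z.2 ^ 2 - (q.1 - ε * (q.2 - z.2) ^ 2)) - (z'.2 ^ 2 - (q.1 - ε * (q.2 - z'.2) ^ 2)) =
        ((z.2 + z'.2) - ε * ((q.2 - z.2) + (q.2 - z'.2))) * (z.2 - z'.2) := by ring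
    rw [e, abs_mul]
    gcongr
    refine le_trans ?_ (le_abs_self _)
    have a1 := abs_le.1 h2
    have a2 := abs_le.1 h2'
    rcases hε with rfl | rfl <;> linarith [a1.1, a1.2, a2.1, a2.2]
  · refine le_of_eq ?_
    field_simp
    ring

theorem lintegral_kernel_output_le (hε : ε = 1 ∨ ε = -1)
    (hne : (interactionSet ε m₀ n₀ m₁ n₁ m₂ n₂).Nonempty) (q : ℝ × ℝ) :
    ∫⁻ r, interactionKernel ε m₀ n₀ m₁ n₁ m₂ n₂ (r, q - r) ^ (2 : ℝ) ≤
      ENNReal.ofReal (1024 * (2 ^ m₀ / 2 ^ m₁) ^ 2 * (2 ^ n₁ * 2 ^ n₂)) := by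
  have hf : Measurable fun r : ℝ × ℝ => (r, q - r) := by fun_prop
  have hM : (1 : ℝ) ≤ 2 ^ m₀ := one_le_pow₀ (by norm_num)
  have hA : ∀ z ∈ (fun r : ℝ × ℝ => (r, q - r)) ⁻¹' interactionSet ε m₀ n₀ m₁ n₁ m₂ n₂,
      |z.1 - z.2 ^ 2| ≤ 2 * 2 ^ n₁ := by
    rintro z ⟨-, -, -, -, -, -, -, -, -, -, h, -⟩
    exact h
  have hB : ∀ z ∈ (fun r : ℝ × ℝ => (r, q - r)) ⁻¹' interactionSet ε m₀ n₀ m₁ n₁ m₂ n₂,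
      |z.1 - (q.1 - ε * (q.2 - z.2) ^ 2)| ≤ 2 * 2 ^ n₂ := by
    rintro z ⟨-, -, -, -, -, -, -, -, -, -, -, h, -⟩
    rw [abs_sub_comm]
    refine le_trans (le_of_eq ?_) h
    congr 1
    simp only [Prod.fst_sub, Prod.snd_sub]
    ring
  rcases Set.eq_empty_or_nonempty
    ((fun r : ℝ × ℝ => (r, q - r)) ⁻¹' interactionSet ε m₀ n₀ m₁ n₁ m₂ n₂) with he | ⟨r₀, hr₀⟩
  · exact lintegral_interactionKernel_sq_le hf zero_le_two (fun r hr => symbol_le_two hr) (a := 0)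
      (by rw [he]; simp) (by rw [mul_zero]; positivity)
  obtain ⟨-, -, c1, -, -, -, -, -, -, c2, -⟩ := hr₀
  have c3 : 0 < q.2 := by simpa using c1
  have c4 : q.2 ≤ 2 * 2 ^ m₀ := by simpa using c2
  rcases hε with rfl | rfl
  · refine lintegral_interactionKernel_sq_le hf zero_le_two (fun r hr => symbol_le_two hr)
      (volume_le_of_strips_quadratic (hf (measurableSet_interactionSet ..)) (p := fun x => x ^ 2)
        (r := fun x => q.1 - 1 * (q.2 - x) ^ 2) (A := 2 * 2 ^ n₁) (B := 2 * 2 ^ n₂)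
        (by positivity) (by positivity) hA hB ?_) ?_
    · rintro z ⟨-, h2, -, h1, -⟩ z' ⟨-, h2', -, h1', -⟩
      simp only [Prod.snd_sub] at h1 h2 h1' h2'
      have e : (z.2 ^ 2 - (q.1 - 1 * (q.2 - z.2) ^ 2)) - (z'.2 ^ 2 - (q.1 - 1 * (q.2 - z'.2) ^ 2)) =
          2 * ((z.2 - z'.2) * (z.2 + z'.2 - q.2)) := by ring
      rw [e, abs_mul, abs_mul, abs_two, sq]
      gcongr 2 * (_ * ?_)
      have a1 := (abs_le.1 h2).2
      have a2 := (abs_le.1 h2').2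
      exact (abs_le.2 ⟨by linarith, by linarith⟩ : _ ≤ z.2 + z'.2 - q.2).trans (le_abs_self _)
    · obtain ⟨z, -, -, -, d1, d2, -, -, -, -, d3, -⟩ := hne
      have hK : (1 : ℝ) ≤ 2 ^ n₁ := one_le_pow₀ (by norm_num)
      have h1 : √(2 * 2 ^ n₁ : ℝ) ≤ 2 * 2 ^ n₁ :=
        Real.sqrt_le_iff.2 ⟨by positivity, by nlinarith⟩
      have h2 : (1 / 4 : ℝ) ≤ 2 ^ m₀ / 2 ^ m₁ := by
        rw [le_div_iff₀ (by positivity)]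
        linarith
      have h3 : (1 / 4 : ℝ) ^ 2 ≤ (2 ^ m₀ / 2 ^ m₁) ^ 2 := by gcongr
      calc (2 : ℝ) ^ 2 * (4 * (2 * 2 ^ n₂) * √(2 * 2 ^ n₁))
          ≤ 2 ^ 2 * (4 * (2 * 2 ^ n₂) * (2 * 2 ^ n₁)) := by gcongr
        _ = 1024 * (1 / 4) ^ 2 * (2 ^ n₁ * 2 ^ n₂) := by ring
        _ ≤ _ := by gcongr
  · refine lintegral_interactionKernel_sq_le hf (c := 2 * q.2 / 2 ^ m₁) (by positivity)
      (fun r hr => ?_)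
      (volume_le_of_strips_linear (hf (measurableSet_interactionSet ..)) (p := fun x => x ^ 2)
        (r := fun x => q.1 - -1 * (q.2 - x) ^ 2) (A := 2 * 2 ^ n₁) (B := 2 * 2 ^ n₂)
        (δ := 2 * q.2) (by positivity) (by positivity) (by positivity) hA hB ?_) ?_
    · simpa using symbol_le_div hr
    · rintro z - z' -
      have e : (z.2 ^ 2 - (q.1 - -1 * (q.2 - z.2) ^ 2)) -
          (z'.2 ^ 2 - (q.1 - -1 * (q.2 - z'.2) ^ 2)) = 2 * q.2 * (z.2 - z'.2) := by ring
      rw [e, abs_mul, abs_of_pos (by positivity : 0 < 2 * q.2)]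
    · calc (2 * q.2 / 2 ^ m₁) ^ 2 * (8 * (2 * 2 ^ n₁) * (2 * 2 ^ n₂) / (2 * q.2))
          = 64 * (q.2 / (2 ^ m₁) ^ 2) * (2 ^ n₁ * 2 ^ n₂) := by
            field_simp
            ring
        _ ≤ 64 * (16 * (2 ^ m₀ / 2 ^ m₁) ^ 2) * (2 ^ n₁ * 2 ^ n₂) := by
            gcongr
            rw [div_pow, mul_div_assoc', div_le_div_iff_of_pos_right (by positivity)]
            nlinarith
        _ = _ := by ring

theorem lintegral_kernel_high_le (hε : ε = 1 ∨ ε = -1)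
    (hne : (interactionSet ε m₀ n₀ m₁ n₁ m₂ n₂).Nonempty)
    (hK : (2 : ℝ) ^ n₀ ≤ 64 * (2 ^ m₂) ^ 2) (r : ℝ × ℝ) :
    ∫⁻ t, interactionKernel ε m₀ n₀ m₁ n₁ m₂ n₂ (r, t) ^ (2 : ℝ) ≤
      ENNReal.ofReal (16384 * (2 ^ m₀ / 2 ^ m₁) ^ 2 * (√(2 ^ n₀) * 2 ^ n₂)) := by
  have hf : Measurable fun t : ℝ × ℝ => (r, t) := by fun_prop
  have hS := hf (measurableSet_interactionSet ε m₀ n₀ m₁ n₁ m₂ n₂)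
  have hA : ∀ z ∈ (fun t : ℝ × ℝ => (r, t)) ⁻¹' interactionSet ε m₀ n₀ m₁ n₁ m₂ n₂,
      |z.1 - ε * z.2 ^ 2| ≤ 2 * 2 ^ n₂ := by
    rintro z ⟨-, -, -, -, -, -, -, -, -, -, -, h, -⟩
    exact h
  have hB : ∀ z ∈ (fun t : ℝ × ℝ => (r, t)) ⁻¹' interactionSet ε m₀ n₀ m₁ n₁ m₂ n₂,
      |z.1 - ((r.2 + z.2) ^ 2 - r.1)| ≤ 2 * 2 ^ n₀ := by
    rintro z ⟨-, -, -, -, -, -, -, -, -, -, -, -, h⟩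
    refine le_trans (le_of_eq ?_) h
    congr 1
    ring
  have hs : √(2 ^ n₀ : ℝ) * √(2 ^ n₀) = 2 ^ n₀ := Real.mul_self_sqrt (by positivity)
  rcases hε with rfl | rfl
  · refine lintegral_interactionKernel_sq_le hf (c := 4 * (2 ^ m₀ / 2 ^ m₁)) (by positivity)
      (fun r hr => symbol_le_ratio hr)
      (volume_le_of_strips_linear hS (p := fun y => 1 * y ^ 2)
        (r := fun y => (r.2 + y) ^ 2 - r.1) (A := 2 * 2 ^ n₂) (B := 2 * 2 ^ n₀)
        (δ := 2 ^ m₁) (by positivity) (by positivity) (by positivity) hA hB ?_) ?_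
    · rintro z ⟨-, -, -, -, h, -⟩ z' -
      have e : (1 * z.2 ^ 2 - ((r.2 + z.2) ^ 2 - r.1)) -
          (1 * z'.2 ^ 2 - ((r.2 + z'.2) ^ 2 - r.1)) = -(2 * r.2 * (z.2 - z'.2)) := by ring
      rw [e, abs_neg, abs_mul]
      gcongr
      exact h.trans (le_abs_self _)
    · obtain ⟨z, hz⟩ := hne
      have h1 := low_le_of_mem hz
      have h2 : √(2 ^ n₀ : ℝ) ≤ 32 * 2 ^ m₁ :=
        Real.sqrt_le_iff.2 ⟨by positivity, hK.trans (by
          have : ((2 : ℝ) ^ m₂) ^ 2 ≤ (4 * 2 ^ m₁) ^ 2 := by gcongr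
          linarith)⟩
      have h3 : (2 : ℝ) ^ n₀ / 2 ^ m₁ ≤ 32 * √(2 ^ n₀) := by
        rw [div_le_iff₀ (by positivity)]
        nth_rewrite 1 [← hs]
        nlinarith [Real.sqrt_nonneg (2 ^ n₀ : ℝ)]
      calc (4 * (2 ^ m₀ / 2 ^ m₁)) ^ 2 * (8 * (2 * 2 ^ n₂) * (2 * 2 ^ n₀) / (2 ^ m₁ : ℝ))
          = 512 * (2 ^ m₀ / 2 ^ m₁) ^ 2 * (2 ^ n₀ / 2 ^ m₁ * 2 ^ n₂) := by ring
        _ ≤ 512 * (2 ^ m₀ / 2 ^ m₁) ^ 2 * (32 * √(2 ^ n₀) * 2 ^ n₂) := by gcongr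
        _ = _ := by ring
  · have e : ∀ z z' : ℝ × ℝ, (((r.2 + z.2) ^ 2 - r.1) - -1 * z.2 ^ 2) -
        (((r.2 + z'.2) ^ 2 - r.1) - -1 * z'.2 ^ 2) =
          2 * ((z.2 - z'.2) * (r.2 + z.2 + z'.2)) := fun z z' => by ring
    have hm1 : MeasurableSet {z : ℝ × ℝ | -(r.2 / 2) ≤ z.2} := measurableSet_le (by fun_prop) (by fun_prop)
    have hm2 : MeasurableSet {z : ℝ × ℝ | z.2 ≤ -(r.2 / 2)} := measurableSet_le (by fun_prop) (by fun_prop)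
    refine lintegral_interactionKernel_sq_le hf (c := 4 * (2 ^ m₀ / 2 ^ m₁)) (by positivity)
      (fun r hr => symbol_le_ratio hr)
      (a := 4 * (2 * 2 ^ n₂) * √(2 * 2 ^ n₀) + 4 * (2 * 2 ^ n₂) * √(2 * 2 ^ n₀)) ?_ ?_
    · rw [ENNReal.ofReal_add (by positivity) (by positivity)]
      refine le_trans (measure_mono (fun z hz => ?_)) ((measure_union_le
        ((fun t : ℝ × ℝ => (r, t)) ⁻¹' interactionSet (-1) m₀ n₀ m₁ n₁ m₂ n₂ ∩
          {z | -(r.2 / 2) ≤ z.2})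
        ((fun t : ℝ × ℝ => (r, t)) ⁻¹' interactionSet (-1) m₀ n₀ m₁ n₁ m₂ n₂ ∩
          {z | z.2 ≤ -(r.2 / 2)})).trans (add_le_add
        (volume_le_of_strips_quadratic (hS.inter hm1) (r := fun y => -1 * y ^ 2)
          (p := fun y => (r.2 + y) ^ 2 - r.1) (by positivity) (by positivity)
          (fun z hz => hB z hz.1) (fun z hz => hA z hz.1) ?_)
        (volume_le_of_strips_quadratic (hS.inter hm2) (r := fun y => -1 * y ^ 2)
          (p := fun y => (r.2 + y) ^ 2 - r.1) (by positivity) (by positivity)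
          (fun z hz => hB z hz.1) (fun z hz => hA z hz.1) ?_)))
      · rcases le_total (-(r.2 / 2)) z.2 with h | h
        · exact Or.inl ⟨hz, h⟩
        · exact Or.inr ⟨hz, h⟩
      · rintro z ⟨-, h1⟩ z' ⟨-, h2⟩
        have h1 : -(r.2 / 2) ≤ z.2 := h1
        have h2 : -(r.2 / 2) ≤ z'.2 := h2
        rw [e, abs_mul, abs_mul, abs_two, sq]
        gcongr 2 * (_ * ?_)
        exact (abs_le.2 ⟨by linarith, by linarith⟩ : _ ≤ r.2 + z.2 + z'.2).trans (le_abs_self _)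
      · rintro z ⟨-, h1⟩ z' ⟨-, h2⟩
        have h1 : z.2 ≤ -(r.2 / 2) := h1
        have h2 : z'.2 ≤ -(r.2 / 2) := h2
        rw [e, abs_mul, abs_mul, abs_two, sq]
        gcongr 2 * (_ * ?_)
        exact (abs_le.2 ⟨by linarith, by linarith⟩ : _ ≤ -(r.2 + z.2 + z'.2)).trans (neg_le_abs _)
    · have h1 : √(2 * 2 ^ n₀ : ℝ) ≤ 2 * √(2 ^ n₀) :=
        Real.sqrt_le_iff.2 ⟨by positivity, by
          rw [mul_pow, Real.sq_sqrt (by positivity)]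
          linarith [show (0 : ℝ) ≤ 2 ^ n₀ by positivity]⟩
      calc (4 * (2 ^ m₀ / 2 ^ m₁ : ℝ)) ^ 2 *
            (4 * (2 * 2 ^ n₂) * √(2 * 2 ^ n₀) + 4 * (2 * 2 ^ n₂) * √(2 * 2 ^ n₀))
          ≤ (4 * (2 ^ m₀ / 2 ^ m₁)) ^ 2 * (4 * (2 * 2 ^ n₂) * (2 * √(2 ^ n₀)) +
            4 * (2 * 2 ^ n₂) * (2 * √(2 ^ n₀))) := by gcongr
        _ = 512 * (2 ^ m₀ / 2 ^ m₁) ^ 2 * (√(2 ^ n₀) * 2 ^ n₂) := by ring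
        _ ≤ _ := by gcongr; norm_num

theorem lintegral_kernel_low_le (hm : m₂ ≠ 0)
    (hK : (2 : ℝ) ^ n₀ ≤ 64 * (2 ^ m₂) ^ 2) (t : ℝ × ℝ) :
    ∫⁻ r, interactionKernel ε m₀ n₀ m₁ n₁ m₂ n₂ (r, t) ^ (2 : ℝ) ≤
      ENNReal.ofReal (16384 * (2 ^ m₀ / 2 ^ m₁) ^ 2 * (√(2 ^ n₀) * 2 ^ n₁)) := by
  have hf : Measurable fun r : ℝ × ℝ => (r, t) := by fun_prop
  have hs : √(2 ^ n₀ : ℝ) * √(2 ^ n₀) = 2 ^ n₀ := Real.mul_self_sqrt (by positivity)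
  refine lintegral_interactionKernel_sq_le hf (c := 4 * (2 ^ m₀ / 2 ^ m₁)) (by positivity)
    (fun r hr => symbol_le_ratio hr)
    (volume_le_of_strips_linear (hf (measurableSet_interactionSet ..)) (p := fun x => x ^ 2)
      (r := fun x => (x + t.2) ^ 2 - t.1) (A := 2 * 2 ^ n₁) (B := 2 * 2 ^ n₀)
      (δ := 2 ^ m₂) (by positivity) (by positivity) (by positivity) ?_ ?_ ?_) ?_
  · rintro z ⟨-, -, -, -, -, -, -, -, -, -, h, -⟩
    exact h
  · rintro z ⟨-, -, -, -, -, -, -, -, -, -, -, -, h⟩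
    refine le_trans (le_of_eq ?_) h
    congr 1
    ring
  · rintro z ⟨-, -, -, -, -, -, h, -⟩ z' -
    have e : (z.2 ^ 2 - ((z.2 + t.2) ^ 2 - t.1)) - (z'.2 ^ 2 - ((z'.2 + t.2) ^ 2 - t.1)) =
        -(2 * t.2 * (z.2 - z'.2)) := by ring
    rw [e, abs_neg, abs_mul, abs_mul, abs_two]
    gcongr
    exact h hm
  · have h2 : √(2 ^ n₀ : ℝ) ≤ 8 * 2 ^ m₂ :=
      Real.sqrt_le_iff.2 ⟨by positivity, hK.trans (by linarith)⟩
    have h3 : (2 : ℝ) ^ n₀ / 2 ^ m₂ ≤ 8 * √(2 ^ n₀) := by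
      rw [div_le_iff₀ (by positivity)]
      nth_rewrite 1 [← hs]
      nlinarith [Real.sqrt_nonneg (2 ^ n₀ : ℝ)]
    calc (4 * (2 ^ m₀ / 2 ^ m₁)) ^ 2 * (8 * (2 * 2 ^ n₁) * (2 * 2 ^ n₀) / (2 ^ m₂ : ℝ))
        = 512 * (2 ^ m₀ / 2 ^ m₁) ^ 2 * (2 ^ n₀ / 2 ^ m₂ * 2 ^ n₁) := by ring
      _ ≤ 512 * (2 ^ m₀ / 2 ^ m₁) ^ 2 * (8 * √(2 ^ n₀) * 2 ^ n₁) := by gcongr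
      _ = 4096 * (2 ^ m₀ / 2 ^ m₁) ^ 2 * (√(2 ^ n₀) * 2 ^ n₁) := by ring
      _ ≤ _ := by gcongr; norm_num

theorem resonance_le (hε : ε = 1 ∨ ε = -1) (h0 : m₀ ≠ 0) (h2 : m₂ ≠ 0)
    (hne : (interactionSet ε m₀ n₀ m₁ n₁ m₂ n₂).Nonempty) :
    (2 : ℝ) ^ m₀ * 2 ^ m₂ ≤ 8 * (2 ^ n₀ + 2 ^ n₁ + 2 ^ n₂) := by
  obtain ⟨z, -, a1, a2, a3, -, -, a4, -, a5, -, b1, b2, b0⟩ := hne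
  have h : |z.2.2| * (z.1.2 + z.2.2) ≤ 2 * 2 ^ n₁ + 2 * 2 ^ n₂ + 2 * 2 ^ n₀ := by
    have b1 := abs_le.1 b1
    have b2 := abs_le.1 b2
    have b0 := abs_le.1 b0
    rcases hε with rfl | rfl
    · rw [abs_of_nonneg (by linarith)] at a1 ⊢
      have : z.2.2 * (z.1.2 + z.2.2) ≤ z.2.2 * (2 * z.1.2) :=
        mul_le_mul_of_nonneg_left (by linarith) (by linarith)
      nlinarith [b1.1, b1.2, b2.1, b2.2, b0.1, b0.2]
    · rw [abs_of_nonpos (by linarith)] at a1 ⊢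
      have : 0 ≤ -z.2.2 * (z.1.2 + z.2.2) := mul_nonneg (by linarith) a2.le
      nlinarith [b1.1, b1.2, b2.1, b2.2, b0.1, b0.2]
  have h' : (2 : ℝ) ^ m₂ * 2 ^ m₀ ≤ (2 * |z.2.2|) * (2 * (z.1.2 + z.2.2)) :=
    mul_le_mul (a4 h2) (a5 h0) (by positivity) (by positivity)
  nlinarith

end KernelBounds

section Dyadic

/-- The distance between two natural numbers. -/
def gap (a b : ℕ) : ℕ := (a - b) + (b - a)

/-- The off-diagonal decay of the paraproduct interaction. -/
def offDiag (m₀ n₀ m₁ m₂ : ℕ) : ℝ :=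
  (9 / 10) ^ gap m₀ m₁ *
    ((9 / 10) ^ n₀ + (9 / 10) ^ gap n₀ m₂ + (9 / 10) ^ gap n₀ (m₀ + m₂))

theorem offDiag_nonneg (m₀ n₀ m₁ m₂ : ℕ) : 0 ≤ offDiag m₀ n₀ m₁ m₂ := by
  unfold offDiag; positivity

theorem gap_comm (a b : ℕ) : gap a b = gap b a := Nat.add_comm _ _

theorem two_pow_div_le {a b k : ℕ} (h : a ≤ b + k) :
    (2 : ℝ) ^ a / 2 ^ b ≤ 4 ^ k * ((9 / 10) ^ gap a b) ^ 2 := by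
  rw [← pow_mul, mul_comm (gap a b), pow_mul]
  rcases le_total a b with hab | hab
  · obtain ⟨d, rfl⟩ := Nat.exists_eq_add_of_le hab
    have e : gap a (a + d) = d := by unfold gap; omega
    rw [e, pow_add, div_mul_cancel_left₀ (by positivity), ← inv_pow]
    calc ((2 : ℝ)⁻¹) ^ d ≤ ((9 / 10) ^ 2) ^ d := by gcongr; norm_num
      _ = 1 * ((9 / 10) ^ 2) ^ d := (one_mul _).symm
      _ ≤ _ := by gcongr; exact one_le_pow₀ (by norm_num)
  · obtain ⟨d, rfl⟩ := Nat.exists_eq_add_of_le hab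
    have e : gap (b + d) b = d := by unfold gap; omega
    rw [e, pow_add, mul_div_cancel_left₀ _ (by positivity)]
    calc (2 : ℝ) ^ d ≤ (4 * (9 / 10) ^ 2) ^ d := by gcongr; norm_num
      _ = 4 ^ d * ((9 / 10) ^ 2) ^ d := mul_pow _ _ _
      _ ≤ _ := by gcongr <;> [norm_num; omega]

theorem le_add_of_two_pow_le {a b k : ℕ} (h : (2 : ℝ) ^ a ≤ 2 ^ k * 2 ^ b) : a ≤ b + k := by
  rw [← pow_add, pow_le_pow_iff_right₀ (by norm_num)] at h
  omega

theorem one_le_two_pow_mul (n : ℕ) : (1 : ℝ) ≤ 2 ^ n * ((9 / 10) ^ n) ^ 2 := by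
  rw [← pow_mul, mul_comm n, pow_mul, ← mul_pow]
  exact one_le_pow₀ (by norm_num)

theorem sqrt_two_pow_le (n : ℕ) : √(2 ^ n : ℝ) ≤ 2 ^ n * ((9 / 10) ^ n) ^ 2 := by
  refine Real.sqrt_le_iff.2 ⟨by positivity, ?_⟩
  have h : (2 : ℝ) ^ n * 1 ≤ 2 ^ n * (2 ^ n * ((9 / 10) ^ n) ^ 4) := by
    gcongr
    rw [← pow_mul, mul_comm n, pow_mul]
    rw [← mul_pow]
    exact one_le_pow₀ (by norm_num)
  calc (2 : ℝ) ^ n = 2 ^ n * 1 := (mul_one _).symm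
    _ ≤ _ := h
    _ = _ := by ring

variable {ε : ℝ} {m₀ n₀ m₁ n₁ m₂ n₂ : ℕ}

/-- `A` bounds the squared integral of the interaction kernel in one of its variables. -/
def KernelBound (ε : ℝ) (m₀ n₀ m₁ n₁ m₂ n₂ : ℕ) (A : ℝ) : Prop :=
  (∀ q, ∫⁻ r, interactionKernel ε m₀ n₀ m₁ n₁ m₂ n₂ (r, q - r) ^ (2 : ℝ) ≤ ENNReal.ofReal A) ∨
  (∀ r, ∫⁻ t, interactionKernel ε m₀ n₀ m₁ n₁ m₂ n₂ (r, t) ^ (2 : ℝ) ≤ ENNReal.ofReal A) ∨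
  (∀ t, ∫⁻ r, interactionKernel ε m₀ n₀ m₁ n₁ m₂ n₂ (r, t) ^ (2 : ℝ) ≤ ENNReal.ofReal A)

theorem offDiag_sq_ge_left (m₀ n₀ m₁ m₂ : ℕ) :
    ((9 / 10 : ℝ) ^ gap m₀ m₁) ^ 2 * ((9 / 10) ^ n₀) ^ 2 ≤ offDiag m₀ n₀ m₁ m₂ ^ 2 := by
  rw [← mul_pow]
  unfold offDiag
  gcongr
  rw [add_assoc]
  exact le_add_of_nonneg_right (by positivity)

theorem offDiag_sq_ge_mid (m₀ n₀ m₁ m₂ : ℕ) :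
    ((9 / 10 : ℝ) ^ gap m₀ m₁) ^ 2 * ((9 / 10) ^ gap n₀ m₂) ^ 2 ≤ offDiag m₀ n₀ m₁ m₂ ^ 2 := by
  rw [← mul_pow]
  unfold offDiag
  gcongr
  rw [add_right_comm]
  exact le_add_of_nonneg_left (by positivity)

theorem offDiag_sq_ge_right (m₀ n₀ m₁ m₂ : ℕ) :
    ((9 / 10 : ℝ) ^ gap m₀ m₁) ^ 2 * ((9 / 10) ^ gap n₀ (m₀ + m₂)) ^ 2 ≤
      offDiag m₀ n₀ m₁ m₂ ^ 2 := by
  rw [← mul_pow]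
  unfold offDiag
  gcongr
  exact le_add_of_nonneg_left (by positivity)

theorem ratio_le (hne : (interactionSet ε m₀ n₀ m₁ n₁ m₂ n₂).Nonempty) :
    (2 : ℝ) ^ m₀ / 2 ^ m₁ ≤ 64 * ((9 / 10) ^ gap m₀ m₁) ^ 2 := by
  obtain ⟨z, hz⟩ := hne
  have h : m₀ ≤ m₁ + 3 := le_add_of_two_pow_le (by linarith [out_le_of_mem hz])
  exact (two_pow_div_le h).trans (by norm_num)

theorem ratio_sq_le (hne : (interactionSet ε m₀ n₀ m₁ n₁ m₂ n₂).Nonempty) :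
    ((2 : ℝ) ^ m₀ / 2 ^ m₁) ^ 2 ≤ 512 * ((9 / 10) ^ gap m₀ m₁) ^ 2 := by
  have h := ratio_le hne
  obtain ⟨z, hz⟩ := hne
  have h8 : (2 : ℝ) ^ m₀ / 2 ^ m₁ ≤ 8 := by
    rw [div_le_iff₀ (by positivity)]; exact out_le_of_mem hz
  calc ((2 : ℝ) ^ m₀ / 2 ^ m₁) ^ 2 = (2 : ℝ) ^ m₀ / 2 ^ m₁ * (2 ^ m₀ / 2 ^ m₁) := sq _
    _ ≤ 8 * (64 * ((9 / 10) ^ gap m₀ m₁) ^ 2) := by gcongr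
    _ = _ := by ring

theorem exists_kernelBound_of_resonant (hε : ε = 1 ∨ ε = -1)
    (hne : (interactionSet ε m₀ n₀ m₁ n₁ m₂ n₂).Nonempty) (h0 : m₀ ≠ 0) (h2 : m₂ ≠ 0)
    (hK : 16 * (2 : ℝ) ^ n₀ ≤ 2 ^ m₀ * 2 ^ m₂) (hK' : (2 : ℝ) ^ n₀ ≤ 64 * (2 ^ m₂) ^ 2) :
    ∃ A : ℝ, 0 ≤ A ∧ KernelBound ε m₀ n₀ m₁ n₁ m₂ n₂ A ∧
      A * (2 ^ m₀ * 2 ^ m₂) ≤ 2 ^ 40 * (2 ^ n₀ * 2 ^ n₁ * 2 ^ n₂) * offDiag m₀ n₀ m₁ m₂ ^ 2 := by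
  have hres := resonance_le hε h0 h2 hne
  have hMN : (0 : ℝ) < 2 ^ m₀ * 2 ^ m₂ := by positivity
  have hs := sqrt_two_pow_le n₀
  have hr := ratio_sq_le hne
  have hd := offDiag_sq_ge_left m₀ n₀ m₁ m₂
  have key : 16384 * (2 ^ m₀ / 2 ^ m₁ : ℝ) ^ 2 * √(2 ^ n₀) * 32 * (2 ^ n₁ * 2 ^ n₂) ≤
      2 ^ 40 * (2 ^ n₀ * 2 ^ n₁ * 2 ^ n₂) * offDiag m₀ n₀ m₁ m₂ ^ 2 := by
    calc 16384 * (2 ^ m₀ / 2 ^ m₁ : ℝ) ^ 2 * √(2 ^ n₀) * 32 * (2 ^ n₁ * 2 ^ n₂)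
        ≤ 16384 * (512 * ((9 / 10) ^ gap m₀ m₁) ^ 2) * (2 ^ n₀ * ((9 / 10) ^ n₀) ^ 2) * 32 *
          (2 ^ n₁ * 2 ^ n₂) := by gcongr
      _ = 16384 * 512 * 32 * (2 ^ n₀ * 2 ^ n₁ * 2 ^ n₂) *
          (((9 / 10) ^ gap m₀ m₁) ^ 2 * ((9 / 10) ^ n₀) ^ 2) := by ring
      _ ≤ _ := by gcongr; norm_num
  rcases le_total ((2 : ℝ) ^ n₂) (2 ^ n₁) with h | h
  · refine ⟨_, by positivity, Or.inr (Or.inl (lintegral_kernel_high_le hε hne hK')),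
      le_trans ?_ key⟩
    calc 16384 * (2 ^ m₀ / 2 ^ m₁ : ℝ) ^ 2 * (√(2 ^ n₀) * 2 ^ n₂) * (2 ^ m₀ * 2 ^ m₂)
        ≤ 16384 * (2 ^ m₀ / 2 ^ m₁ : ℝ) ^ 2 * (√(2 ^ n₀) * 2 ^ n₂) * (32 * 2 ^ n₁) :=
          mul_le_mul_of_nonneg_left (by linarith) (by positivity)
      _ = _ := by ring
  · refine ⟨_, by positivity, Or.inr (Or.inr (lintegral_kernel_low_le h2 hK')),
      le_trans ?_ key⟩
    calc 16384 * (2 ^ m₀ / 2 ^ m₁ : ℝ) ^ 2 * (√(2 ^ n₀) * 2 ^ n₁) * (2 ^ m₀ * 2 ^ m₂)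
        ≤ 16384 * (2 ^ m₀ / 2 ^ m₁ : ℝ) ^ 2 * (√(2 ^ n₀) * 2 ^ n₁) * (32 * 2 ^ n₂) :=
          mul_le_mul_of_nonneg_left (by linarith) (by positivity)
      _ = _ := by ring

theorem exists_kernelBound (hε : ε = 1 ∨ ε = -1)
    (hne : (interactionSet ε m₀ n₀ m₁ n₁ m₂ n₂).Nonempty) :
    ∃ A : ℝ, 0 ≤ A ∧ KernelBound ε m₀ n₀ m₁ n₁ m₂ n₂ A ∧
      A * (2 ^ m₀ * 2 ^ m₂) ≤ 2 ^ 40 * (2 ^ n₀ * 2 ^ n₁ * 2 ^ n₂) * offDiag m₀ n₀ m₁ m₂ ^ 2 := by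
  have hr := ratio_le hne
  have hr2 := ratio_sq_le hne
  have hone : ∀ n : ℕ, (1 : ℝ) ≤ 2 ^ n := fun n => one_le_pow₀ (by norm_num)
  obtain ⟨z, hz⟩ := id hne
  have hM := out_le_of_mem hz
  have hN' := low_le_of_mem hz
  rcases le_or_gt (128 * (2 : ℝ) ^ m₂) (2 ^ m₁) with hN | hN
  · rcases le_or_gt ((2 : ℝ) ^ m₂) (2 ^ n₀) with hK | hK
    · refine ⟨_, by positivity, Or.inl fun q => lintegral_kernel_output_le_of_transversal hN q hε,
        ?_⟩
      have h1 : (2 : ℝ) ^ m₂ / 2 ^ n₀ ≤ 4 ^ 0 * ((9 / 10) ^ gap m₂ n₀) ^ 2 :=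
        two_pow_div_le (by rwa [pow_le_pow_iff_right₀ (by norm_num)] at hK)
      rw [pow_zero, one_mul, gap_comm] at h1
      have h2 := offDiag_sq_ge_mid m₀ n₀ m₁ m₂
      calc 256 * (2 ^ n₁ * 2 ^ n₂) / 2 ^ m₁ * ((2 : ℝ) ^ m₀ * 2 ^ m₂)
          = 256 * (2 ^ n₀ * 2 ^ n₁ * 2 ^ n₂) * (2 ^ m₀ / 2 ^ m₁ * (2 ^ m₂ / 2 ^ n₀)) := by
            field_simp
        _ ≤ 256 * (2 ^ n₀ * 2 ^ n₁ * 2 ^ n₂) * (64 * ((9 / 10) ^ gap m₀ m₁) ^ 2 *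
            ((9 / 10) ^ gap n₀ m₂) ^ 2) := by gcongr
        _ = 256 * 64 * (2 ^ n₀ * 2 ^ n₁ * 2 ^ n₂) * (((9 / 10) ^ gap m₀ m₁) ^ 2 *
            ((9 / 10) ^ gap n₀ m₂) ^ 2) := by ring
        _ ≤ _ := by gcongr; norm_num
    · obtain ⟨-, -, -, -, c2, -, -, c4, -, c3, -⟩ := hz
      have hM' : (2 : ℝ) ^ m₁ ≤ 8 * 2 ^ m₀ := by linarith [neg_abs_le z.2.2]
      have hm2 : m₂ ≠ 0 := by
        rintro rfl
        linarith [hone n₀, pow_zero (2 : ℝ)]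
      have hm0 : m₀ ≠ 0 := by
        rintro rfl
        linarith [hone n₀, pow_zero (2 : ℝ)]
      refine exists_kernelBound_of_resonant hε hne hm0 hm2 ?_ ?_
      · nlinarith [hone m₂]
      · nlinarith [hone m₂]
  · have hw := fun q => lintegral_kernel_output_le (n₀ := n₀) (n₁ := n₁) (n₂ := n₂) hε hne q
    rcases le_or_gt ((2 : ℝ) ^ m₀) 1024 with h1 | h1
    · refine ⟨_, by positivity, Or.inl hw, ?_⟩
      have h3 := offDiag_sq_ge_left m₀ n₀ m₁ m₂
      calc 1024 * (2 ^ m₀ / 2 ^ m₁ : ℝ) ^ 2 * (2 ^ n₁ * 2 ^ n₂) * (2 ^ m₀ * 2 ^ m₂)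
          ≤ 1024 * (2 ^ m₀ / 2 ^ m₁ : ℝ) ^ 2 * (2 ^ n₁ * 2 ^ n₂) * (2 ^ m₀ * (4 * 2 ^ m₁)) := by
            gcongr
        _ = 4096 * (2 ^ m₀ * 2 ^ m₀) * (2 ^ m₀ / 2 ^ m₁) * 1 * (2 ^ n₁ * 2 ^ n₂) := by
            field_simp
            ring
        _ ≤ 4096 * (1024 * 1024) * (64 * ((9 / 10) ^ gap m₀ m₁) ^ 2) *
            (2 ^ n₀ * ((9 / 10) ^ n₀) ^ 2) * (2 ^ n₁ * 2 ^ n₂) := by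
            gcongr
            exact one_le_two_pow_mul n₀
        _ = 4096 * (1024 * 1024) * 64 * (2 ^ n₀ * 2 ^ n₁ * 2 ^ n₂) *
            (((9 / 10) ^ gap m₀ m₁) ^ 2 * ((9 / 10) ^ n₀) ^ 2) := by ring
        _ ≤ _ := by gcongr; norm_num
    rcases le_or_gt (16 * (2 : ℝ) ^ n₀) (2 ^ m₀ * 2 ^ m₂) with h2 | h2
    · have hm0 : m₀ ≠ 0 := by
        rintro rfl
        linarith [pow_zero (2 : ℝ)]
      have hm2 : m₂ ≠ 0 := by
        rintro rfl
        linarith [pow_zero (2 : ℝ)]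
      refine exists_kernelBound_of_resonant hε hne hm0 hm2 h2 ?_
      nlinarith [hone m₂]
    · refine ⟨_, by positivity, Or.inl hw, ?_⟩
      have h3 : (2 : ℝ) ^ (m₀ + m₂) / 2 ^ n₀ ≤ 4 ^ 4 * ((9 / 10) ^ gap (m₀ + m₂) n₀) ^ 2 :=
        two_pow_div_le (le_add_of_two_pow_le (by rw [pow_add]; linarith))
      rw [gap_comm, pow_add] at h3
      have h4 := offDiag_sq_ge_right m₀ n₀ m₁ m₂
      calc 1024 * (2 ^ m₀ / 2 ^ m₁ : ℝ) ^ 2 * (2 ^ n₁ * 2 ^ n₂) * (2 ^ m₀ * 2 ^ m₂)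
          = 1024 * (2 ^ m₀ / 2 ^ m₁ : ℝ) ^ 2 * (2 ^ n₀ * 2 ^ n₁ * 2 ^ n₂) *
            (2 ^ m₀ * 2 ^ m₂ / 2 ^ n₀) := by field_simp
        _ ≤ 1024 * (512 * ((9 / 10) ^ gap m₀ m₁) ^ 2) * (2 ^ n₀ * 2 ^ n₁ * 2 ^ n₂) *
            (4 ^ 4 * ((9 / 10) ^ gap n₀ (m₀ + m₂)) ^ 2) := by gcongr
        _ = 1024 * 512 * 4 ^ 4 * (2 ^ n₀ * 2 ^ n₁ * 2 ^ n₂) *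
            (((9 / 10) ^ gap m₀ m₁) ^ 2 * ((9 / 10) ^ gap n₀ (m₀ + m₂)) ^ 2) := by ring
        _ ≤ _ := by gcongr; norm_num

end Dyadic

section Trilinear

theorem lintegral_mul_lintegral_le {h : ℝ × ℝ → ℝ≥0∞} {k F : (ℝ × ℝ) × (ℝ × ℝ) → ℝ≥0∞}
    (hh : Measurable h) (hk : Measurable k) (hF : Measurable F) {A : ℝ≥0∞}
    (hA : ∀ a, ∫⁻ b, k (a, b) ^ (2 : ℝ) ≤ A) :
    ∫⁻ a, ∫⁻ b, h a * (k (a, b) * F (a, b)) ≤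
      A ^ (1 / 2 : ℝ) * (l2 h * (∫⁻ a, ∫⁻ b, F (a, b) ^ (2 : ℝ)) ^ (1 / 2 : ℝ)) := by
  have hF2 : Measurable fun a => ∫⁻ b, F (a, b) ^ (2 : ℝ) :=
    Measurable.lintegral_prod_right' (f := fun z => F z ^ (2 : ℝ)) (hF.pow_const _)
  have h22 : (2 : ℝ).HolderConjugate 2 := Real.HolderConjugate.two_two
  calc ∫⁻ a, ∫⁻ b, h a * (k (a, b) * F (a, b))
      ≤ ∫⁻ a, A ^ (1 / 2 : ℝ) * (h a * (∫⁻ b, F (a, b) ^ (2 : ℝ)) ^ (1 / 2 : ℝ)) := by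
        refine lintegral_mono fun a => ?_
        rw [lintegral_const_mul _ (by fun_prop), mul_left_comm]
        gcongr
        refine (ENNReal.lintegral_mul_le_Lp_mul_Lq volume h22
          (hk.comp measurable_prodMk_left).aemeasurable
          (hF.comp measurable_prodMk_left).aemeasurable).trans ?_
        exact mul_le_mul' (ENNReal.rpow_le_rpow (hA a) (by norm_num)) le_rfl
    _ = A ^ (1 / 2 : ℝ) * ∫⁻ a, h a * (∫⁻ b, F (a, b) ^ (2 : ℝ)) ^ (1 / 2 : ℝ) :=
        lintegral_const_mul _ (hh.mul (hF2.pow_const _))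
    _ ≤ _ := by
        gcongr
        refine (ENNReal.lintegral_mul_le_Lp_mul_Lq volume h22 hh.aemeasurable
          (hF2.pow_const _).aemeasurable).trans (le_of_eq ?_)
        congr 3
        ext a
        rw [← ENNReal.rpow_mul]
        norm_num

theorem lintegral_lintegral_sub {f : (ℝ × ℝ) × (ℝ × ℝ) → ℝ≥0∞} (hf : Measurable f) :
    ∫⁻ q, ∫⁻ r, f (r, q - r) = ∫⁻ r, ∫⁻ t, f (r, t) := by
  rw [lintegral_lintegral_swap (by
    exact (hf.comp (by fun_prop :
      Measurable fun z : (ℝ × ℝ) × (ℝ × ℝ) => (z.2, z.1 - z.2))).aemeasurable)]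
  exact lintegral_congr fun r => lintegral_sub_right_eq_self (fun t => f (r, t)) r

theorem lintegral_lintegral_sq_mul {u v : ℝ × ℝ → ℝ≥0∞} (hu : Measurable u) (hv : Measurable v) :
    (∫⁻ r, ∫⁻ t, (u r * v t) ^ (2 : ℝ)) ^ (1 / 2 : ℝ) = l2 u * l2 v := by
  rw [l2, l2, ← ENNReal.mul_rpow_of_nonneg _ _ (by norm_num : (0 : ℝ) ≤ 1 / 2),
    ← lintegral_mul_const _ (hu.pow_const _)]
  congr 1
  refine lintegral_congr fun r => ?_
  rw [← lintegral_const_mul _ (hv.pow_const _)]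
  exact lintegral_congr fun t => ENNReal.mul_rpow_of_nonneg _ _ zero_le_two

theorem lintegral_lintegral_sq_mul_add {g v : ℝ × ℝ → ℝ≥0∞} (hg : Measurable g)
    (hv : Measurable v) :
    (∫⁻ r, ∫⁻ t, (g (r + t) * v t) ^ (2 : ℝ)) ^ (1 / 2 : ℝ) = l2 g * l2 v := by
  rw [← lintegral_lintegral_sq_mul hg hv, lintegral_lintegral_swap (by fun_prop),
    lintegral_lintegral_swap (f := fun r t => (g r * v t) ^ (2 : ℝ)) (by fun_prop)]
  congr 1
  exact lintegral_congr fun t => lintegral_add_right_eq_self (fun r => (g r * v t) ^ (2 : ℝ)) t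

theorem trilinear_le {g u v : ℝ × ℝ → ℝ≥0∞} (hg : Measurable g) (hu : Measurable u)
    (hv : Measurable v) {ε A : ℝ} {m₀ n₀ m₁ n₁ m₂ n₂ : ℕ}
    (hA : KernelBound ε m₀ n₀ m₁ n₁ m₂ n₂ A) :
    ∫⁻ q, ∫⁻ r, g q * (interactionKernel ε m₀ n₀ m₁ n₁ m₂ n₂ (r, q - r) * (u r * v (q - r))) ≤
      ENNReal.ofReal A ^ (1 / 2 : ℝ) * (l2 g * (l2 u * l2 v)) := by
  have hk := measurable_interactionKernel ε m₀ n₀ m₁ n₁ m₂ n₂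
  set k := interactionKernel ε m₀ n₀ m₁ n₁ m₂ n₂
  have e1 : ∫⁻ q, ∫⁻ r, g q * (k (r, q - r) * (u r * v (q - r))) =
      ∫⁻ r, ∫⁻ t, u r * (k (r, t) * (g (r + t) * v t)) := by
    rw [← lintegral_lintegral_sub
      (f := fun z => u z.1 * (k z * (g (z.1 + z.2) * v z.2))) (by fun_prop)]
    refine lintegral_congr fun q => lintegral_congr fun r => ?_
    simp only [add_sub_cancel]
    ring
  rcases hA with hA | hA | hA
  · refine (lintegral_mul_lintegral_le hg (k := fun z => k (z.2, z.1 - z.2))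
      (F := fun z => u z.2 * v (z.1 - z.2)) (by fun_prop) (by fun_prop) hA).trans (le_of_eq ?_)
    rw [← lintegral_lintegral_sq_mul hu hv, ← lintegral_lintegral_sub
      (f := fun z => (u z.1 * v z.2) ^ (2 : ℝ)) (by fun_prop)]
  · rw [e1]
    refine (lintegral_mul_lintegral_le hu (k := k)
      (F := fun z => g (z.1 + z.2) * v z.2) hk (by fun_prop) hA).trans (le_of_eq ?_)
    rw [lintegral_lintegral_sq_mul_add hg hv]
    ring
  · have e2 : ∫⁻ r, ∫⁻ t, u r * (k (r, t) * (g (r + t) * v t)) =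
        ∫⁻ t, ∫⁻ r, v t * (k (r, t) * (g (t + r) * u r)) := by
      rw [lintegral_lintegral_swap (by fun_prop)]
      refine lintegral_congr fun t => lintegral_congr fun r => ?_
      rw [add_comm t r]
      ring
    rw [e1, e2]
    refine (lintegral_mul_lintegral_le hv (k := fun z => k (z.2, z.1))
      (F := fun z => g (z.1 + z.2) * u z.2) (by fun_prop) (by fun_prop) hA).trans (le_of_eq ?_)
    rw [lintegral_lintegral_sq_mul_add hg hu]
    ring

/-- The dyadic weight of the Bourgain norm. -/
def weight (σ b : ℝ) (m n : ℕ) : ℝ := (2 : ℝ) ^ (((m : ℝ) - 1) * σ + ((n : ℝ) - 1) * b)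

theorem weight_pos (σ b : ℝ) (m n : ℕ) : 0 < weight σ b m n := by
  unfold weight; positivity

theorem weight_mul_sqrt_le {s s' : ℝ} (hss' : -(1 / 2 : ℝ) ≤ s + s') (hs' : s' ≤ -(1 / 2 : ℝ))
    {m₀ m₁ m₂ : ℕ} (n₀ n₁ n₂ : ℕ) (h01 : m₀ ≤ m₁ + 3) (h21 : m₂ ≤ m₁ + 2) {A d : ℝ}
    (hd : 0 ≤ d)
    (hA : A * (2 ^ m₀ * 2 ^ m₂) ≤ 2 ^ 40 * (2 ^ n₀ * 2 ^ n₁ * 2 ^ n₂) * d ^ 2) :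
    weight (s + s' + 1) (-(1 / 2)) m₀ n₀ * √A ≤
      2 ^ 20 * (2 : ℝ) ^ (-2 * (s' + 1 / 2) + 3 * (s + s' + 1 / 2) + 1 / 2) * d *
        (weight s (1 / 2) m₁ n₁ * weight s' (1 / 2) m₂ n₂) := by
  have h2 : (0 : ℝ) < 2 := two_pos
  set e : ℝ := ((n₀ : ℝ) + n₁ + n₂ - m₀ - m₂) / 2 with he
  have h1 : √A ≤ 2 ^ 20 * (2 : ℝ) ^ e * d := by
    refine Real.sqrt_le_iff.2 ⟨by positivity, ?_⟩
    have e2 : ((2 : ℝ) ^ e) ^ 2 * (2 ^ m₀ * 2 ^ m₂) = 2 ^ n₀ * 2 ^ n₁ * 2 ^ n₂ := by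
      rw [← Real.rpow_natCast ((2 : ℝ) ^ e), ← Real.rpow_mul h2.le]
      simp only [← Real.rpow_natCast (2 : ℝ), ← Real.rpow_add h2]
      congr 1
      rw [he]; push_cast; ring
    rw [← mul_le_mul_iff_left₀ (by positivity : (0 : ℝ) < 2 ^ m₀ * 2 ^ m₂)]
    refine hA.trans (le_of_eq ?_)
    rw [← e2]; ring
  have h3 : weight (s + s' + 1) (-(1 / 2)) m₀ n₀ * (2 : ℝ) ^ e ≤
      (2 : ℝ) ^ (-2 * (s' + 1 / 2) + 3 * (s + s' + 1 / 2) + 1 / 2) *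
        (weight s (1 / 2) m₁ n₁ * weight s' (1 / 2) m₂ n₂) := by
    unfold weight
    simp only [← Real.rpow_add h2]
    refine Real.rpow_le_rpow_of_exponent_le one_le_two ?_
    have c1 : (m₀ : ℝ) ≤ m₁ + 3 := by exact_mod_cast h01
    have c2 : (m₂ : ℝ) ≤ m₁ + 2 := by exact_mod_cast h21
    rw [he]
    nlinarith [mul_nonneg (sub_nonneg.2 c1) (by linarith : 0 ≤ s + s' + 1 / 2),
      mul_nonneg (sub_nonneg.2 c2) (by linarith : 0 ≤ -(s' + 1 / 2))]
  calc weight (s + s' + 1) (-(1 / 2)) m₀ n₀ * √A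
      ≤ weight (s + s' + 1) (-(1 / 2)) m₀ n₀ * (2 ^ 20 * (2 : ℝ) ^ e * d) :=
        mul_le_mul_of_nonneg_left h1 (weight_pos ..).le
    _ = 2 ^ 20 * d * (weight (s + s' + 1) (-(1 / 2)) m₀ n₀ * (2 : ℝ) ^ e) := by ring
    _ ≤ 2 ^ 20 * d * _ := mul_le_mul_of_nonneg_left h3 (by positivity)
    _ = _ := by ring

theorem exists_weighted_trilinear_le {s s' : ℝ} (hss' : -(1 / 2 : ℝ) ≤ s + s')
    (hs' : s' ≤ -(1 / 2 : ℝ)) {ε : ℝ} (hε : ε = 1 ∨ ε = -1) :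
    ∃ C : ℝ, 0 < C ∧ ∀ (m₀ n₀ m₁ n₁ m₂ n₂ : ℕ) (g u v : ℝ × ℝ → ℝ≥0∞), Measurable g →
      Measurable u → Measurable v →
      ENNReal.ofReal (weight (s + s' + 1) (-(1 / 2)) m₀ n₀) *
        ∫⁻ q, ∫⁻ r, g q *
          (interactionKernel ε m₀ n₀ m₁ n₁ m₂ n₂ (r, q - r) * (u r * v (q - r))) ≤
      ENNReal.ofReal C * ENNReal.ofReal (offDiag m₀ n₀ m₁ m₂) *
        ((ENNReal.ofReal (weight s (1 / 2) m₁ n₁) * l2 u) *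
          (ENNReal.ofReal (weight s' (1 / 2) m₂ n₂) * l2 v)) * l2 g := by
  refine ⟨2 ^ 20 * (2 : ℝ) ^ (-2 * (s' + 1 / 2) + 3 * (s + s' + 1 / 2) + 1 / 2), by positivity,
    fun m₀ n₀ m₁ n₁ m₂ n₂ g u v hg hu hv => ?_⟩
  rcases Set.eq_empty_or_nonempty (interactionSet ε m₀ n₀ m₁ n₁ m₂ n₂) with he | hne
  · simp [interactionKernel, he]
  obtain ⟨A, -, hK, hA⟩ := exists_kernelBound hε hne
  obtain ⟨z, hz⟩ := hne
  have h01 : m₀ ≤ m₁ + 3 := le_add_of_two_pow_le (by linarith [out_le_of_mem hz])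
  have h21 : m₂ ≤ m₁ + 2 := le_add_of_two_pow_le (by linarith [low_le_of_mem hz])
  have h := weight_mul_sqrt_le hss' hs' n₀ n₁ n₂ h01 h21 (offDiag_nonneg m₀ n₀ m₁ m₂) hA
  have hs : ENNReal.ofReal A ^ (1 / 2 : ℝ) ≤ ENNReal.ofReal √A := by
    rcases le_total 0 A with h0 | h0
    · rw [ENNReal.ofReal_rpow_of_nonneg h0 (by norm_num), Real.sqrt_eq_rpow]
    · rw [ENNReal.ofReal_of_nonpos h0]; simp
  calc ENNReal.ofReal (weight (s + s' + 1) (-(1 / 2)) m₀ n₀) * _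
      ≤ ENNReal.ofReal (weight (s + s' + 1) (-(1 / 2)) m₀ n₀) *
        (ENNReal.ofReal √A * (l2 g * (l2 u * l2 v))) := by
        gcongr
        refine (trilinear_le hg hu hv hK).trans ?_
        gcongr
    _ = ENNReal.ofReal (weight (s + s' + 1) (-(1 / 2)) m₀ n₀ * √A) * (l2 g * (l2 u * l2 v)) := by
        rw [ENNReal.ofReal_mul (weight_pos ..).le, mul_assoc]
    _ ≤ _ := mul_le_mul' (ENNReal.ofReal_le_ofReal h) le_rfl
    _ = _ := by
        rw [ENNReal.ofReal_mul (mul_nonneg (by positivity) (offDiag_nonneg m₀ n₀ m₁ m₂)),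
          ENNReal.ofReal_mul (weight_pos ..).le, ENNReal.ofReal_mul (by positivity)]
        ring

end Trilinear

section Summation

theorem tsum_pow_gap_le (a : ℕ) :
    ∑' n, ENNReal.ofReal ((9 / 10) ^ gap n a) ≤ 20 := by
  set ρ : ℝ≥0∞ := ENNReal.ofReal (9 / 10) with hρ
  have hgeo : ∑' k : ℕ, ρ ^ k = 10 := by
    rw [ENNReal.tsum_geometric, hρ, ← ENNReal.ofReal_one, ← ENNReal.ofReal_sub _ (by norm_num),
      ← ENNReal.ofReal_inv_of_pos (by norm_num)]
    norm_num
  have h1 : ∀ k : ℕ, ∑' n : ℕ, (if n = a + k then (1 : ℝ≥0∞) else 0) ≤ 1 := fun k => by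
    rw [tsum_ite_eq]
  have h2 : ∀ k : ℕ, ∑' n : ℕ, (if a = n + k then (1 : ℝ≥0∞) else 0) ≤ 1 := fun k => by
    rw [tsum_eq_single (a - k) fun n hn => if_neg (by omega)]
    split_ifs <;> simp
  calc ∑' n, ENNReal.ofReal ((9 / 10) ^ gap n a)
      ≤ ∑' n, ∑' k, ρ ^ k * ((if n = a + k then 1 else 0) + (if a = n + k then 1 else 0)) := by
        refine ENNReal.tsum_le_tsum fun n => le_trans ?_ (ENNReal.le_tsum (gap n a))
        rw [ENNReal.ofReal_pow (by norm_num)]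
        refine le_mul_of_one_le_right' ?_
        rcases le_total a n with h | h
        · rw [if_pos (show n = a + gap n a by unfold gap; omega)]
          exact le_self_add
        · rw [if_pos (show a = n + gap n a by unfold gap; omega)]
          exact le_add_self
    _ = ∑' k, ρ ^ k * (∑' n, (if n = a + k then 1 else 0) + ∑' n, (if a = n + k then 1 else 0)) := by
        rw [ENNReal.tsum_comm]
        refine tsum_congr fun k => ?_
        rw [ENNReal.tsum_mul_left, ENNReal.tsum_add]
    _ ≤ ∑' k, ρ ^ k * 2 := by
        refine ENNReal.tsum_le_tsum fun k => mul_le_mul' le_rfl ?_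
        rw [← one_add_one_eq_two]
        exact add_le_add (h1 k) (h2 k)
    _ = 20 := by
        rw [ENNReal.tsum_mul_right, hgeo]; norm_num

theorem tsum_offDiag_le (m₁ m₂ : ℕ) :
    ∑' p : ℕ × ℕ, ENNReal.ofReal (offDiag p.1 p.2 m₁ m₂) ≤ ENNReal.ofReal 1200 := by
  rw [ENNReal.tsum_prod (f := fun m₀ n₀ => ENNReal.ofReal (offDiag m₀ n₀ m₁ m₂))]
  have h0 : ∑' n, ENNReal.ofReal ((9 / 10 : ℝ) ^ n) ≤ 20 := by
    simpa [gap] using tsum_pow_gap_le 0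
  calc ∑' m₀, ∑' n₀, ENNReal.ofReal (offDiag m₀ n₀ m₁ m₂)
      = ∑' m₀, ENNReal.ofReal ((9 / 10) ^ gap m₀ m₁) *
          (∑' n, ENNReal.ofReal ((9 / 10 : ℝ) ^ n) + ∑' n, ENNReal.ofReal ((9 / 10) ^ gap n m₂) +
            ∑' n, ENNReal.ofReal ((9 / 10) ^ gap n (m₀ + m₂))) := by
        refine tsum_congr fun m₀ => ?_
        rw [← ENNReal.tsum_add, ← ENNReal.tsum_add, ← ENNReal.tsum_mul_left]
        refine tsum_congr fun n₀ => ?_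
        unfold offDiag
        rw [ENNReal.ofReal_mul (by positivity), ENNReal.ofReal_add (by positivity) (by positivity),
          ENNReal.ofReal_add (by positivity) (by positivity)]
    _ ≤ ∑' m₀, ENNReal.ofReal ((9 / 10) ^ gap m₀ m₁) * (20 + 20 + 20) := by
        refine ENNReal.tsum_le_tsum fun m₀ => mul_le_mul' le_rfl ?_
        exact add_le_add (add_le_add h0 (tsum_pow_gap_le _)) (tsum_pow_gap_le _)
    _ = (∑' m₀, ENNReal.ofReal ((9 / 10) ^ gap m₀ m₁)) * 60 := by
        rw [ENNReal.tsum_mul_right]; norm_num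
    _ ≤ 20 * 60 := by gcongr; exact tsum_pow_gap_le _
    _ = _ := by norm_num

/-- The size of the paraproduct symbol. -/
def symbolSize : (ℝ × ℝ) × (ℝ × ℝ) → ℝ≥0∞ :=
  {z | 2 ≤ z.1.2 ∧ |z.2.2| ≤ z.1.2 ∧ 0 < z.1.2 + z.2.2}.indicator fun z =>
    ENNReal.ofReal ((z.1.2 + z.2.2) / z.1.2)

theorem measurable_symbolSize : Measurable symbolSize := by
  refine Measurable.indicator (by fun_prop) ?_
  simp only [Set.ofPred_and]
  exact (measurableSet_le (by fun_prop) (by fun_prop)).inter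
    ((measurableSet_le (by fun_prop) (by fun_prop)).inter
      (measurableSet_lt (by fun_prop) (by fun_prop)))

theorem symbolSize_le_two (z : (ℝ × ℝ) × (ℝ × ℝ)) : symbolSize z ≤ 2 := by
  refine Set.indicator_apply_le' (fun h => ?_) fun _ => zero_le
  obtain ⟨h1, h2, h3⟩ := h
  rw [← ENNReal.ofReal_ofNat 2]
  refine ENNReal.ofReal_le_ofReal ?_
  rw [div_le_iff₀ (by linarith)]
  linarith [le_abs_self z.2.2]

variable {φ : 𝓢(ℝ, ℂ)}

theorem exists_sum_symbol_le (hφ : IsLPfilter φ) :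
    ∃ C : ℝ, 0 < C ∧ ∀ z : (ℝ × ℝ) × (ℝ × ℝ), 0 ≤ z.1.2 →
      ∑' i : ℕ, ‖psiLP φ (i + 2) z.1.2 * FT φ (((2 : ℝ) ^ i)⁻¹ * z.2.2)‖ₑ ≤
        ENNReal.ofReal C * symbolSize z := by
  obtain ⟨B, hB1, hB, hL⟩ := exists_bound_FT φ
  have hB0 : 0 < B := by linarith
  refine ⟨32 * B ^ 2, by positivity, fun z hz => ?_⟩
  obtain ⟨⟨a, x⟩, b, y⟩ := z
  simp only at hz ⊢
  set f : ℕ → ℝ≥0∞ := fun i => ‖psiLP φ (i + 2) x * FT φ (((2 : ℝ) ^ i)⁻¹ * y)‖ₑ with hf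
  have hsupp : ∀ i, f i ≠ 0 → (2 : ℝ) ^ (i + 1) < x ∧ x < 2 ^ (i + 3) ∧ |y| < 2 ^ (i + 1) := by
    intro i hi
    have h1 : psiLP φ (i + 2) x ≠ 0 := fun h => hi (by simp [hf, h])
    have h2 : FT φ (((2 : ℝ) ^ i)⁻¹ * y) ≠ 0 := fun h => hi (by simp [hf, h])
    refine ⟨?_, ?_, ?_⟩ <;> by_contra! h
    · exact h1 (psiLP_eq_zero_of_le hφ (by rwa [abs_of_nonneg hz]))
    · refine h1 (psiLP_eq_zero_of_ge hφ ?_)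
      rw [abs_of_nonneg hz]
      exact (le_of_eq (by ring)).trans h
    · refine h2 (hφ.2 _ ?_)
      rw [abs_mul, abs_of_pos (by positivity : (0 : ℝ) < (2 ^ i)⁻¹), inv_mul_eq_div,
        le_div_iff₀ (by positivity)]
      exact (le_of_eq (by ring)).trans h
  by_cases hne : ∃ i, f i ≠ 0
  swap
  · push Not at hne
    rw [show ∑' i, f i = 0 by simp [hne]]
    exact zero_le
  classical
  set i₀ := Nat.find hne with hi₀
  have hsum : ∑' i, f i = f i₀ + f (i₀ + 1) := by
    rw [tsum_eq_sum (s := {i₀, i₀ + 1}), Finset.sum_pair (by omega)]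
    intro i hi
    by_contra h
    have h1 : i₀ ≤ i := Nat.find_min' hne h
    have h2 := (hsupp i h).1.trans (hsupp i₀ (Nat.find_spec hne)).2.1
    rw [pow_lt_pow_iff_right₀ (by norm_num)] at h2
    simp only [Finset.mem_insert, Finset.mem_singleton, not_or] at hi
    omega
  have hmem : 2 ≤ x ∧ |y| ≤ x ∧ 0 < x + y := by
    obtain ⟨h1, -, h2⟩ := hsupp i₀ (Nat.find_spec hne)
    have h3 : (1 : ℝ) ≤ 2 ^ i₀ := one_le_pow₀ (by norm_num)
    rw [pow_succ] at h1 h2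
    exact ⟨by linarith, by linarith, by linarith [neg_abs_le y]⟩
  have hx : 0 < x := by linarith
  have hterm : ∀ i, f i ≤ ENNReal.ofReal (16 * B ^ 2 * ((x + y) / x)) := by
    intro i
    by_cases hi : f i = 0
    · rw [hi]; exact zero_le
    obtain ⟨h1, h2, h3⟩ := hsupp i hi
    have hp : (0 : ℝ) < 2 ^ i := by positivity
    show ‖psiLP φ (i + 2) x * FT φ (((2 : ℝ) ^ i)⁻¹ * y)‖ₑ ≤ _
    rw [← ofReal_norm, norm_mul]
    refine ENNReal.ofReal_le_ofReal ?_
    have c1 : ‖FT φ (((2 : ℝ) ^ i)⁻¹ * y)‖ ≤ B * ((2 ^ i)⁻¹ * (x + y)) := by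
      rw [pow_succ] at h1 h3
      rcases le_total 0 y with hy | hy
      · have := hL ((2 ^ i)⁻¹ * y) 2
        rw [hφ.2 2 (by norm_num), sub_zero] at this
        refine this.trans (mul_le_mul_of_nonneg_left ?_ hB0.le)
        rw [abs_of_nonneg hy] at h3
        rw [show (2 ^ i)⁻¹ * y - 2 = (2 ^ i)⁻¹ * (y - 2 ^ i * 2) by field_simp, abs_mul,
          abs_of_pos (by positivity : (0 : ℝ) < (2 ^ i)⁻¹)]
        gcongr
        rw [abs_of_neg (by linarith)]
        linarith
      · have := hL ((2 ^ i)⁻¹ * y) (-2)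
        rw [hφ.2 (-2) (by norm_num), sub_zero] at this
        refine this.trans (mul_le_mul_of_nonneg_left ?_ hB0.le)
        rw [abs_of_nonpos hy] at h3
        rw [show (2 ^ i)⁻¹ * y - -2 = (2 ^ i)⁻¹ * (y + 2 ^ i * 2) by field_simp; ring, abs_mul,
          abs_of_pos (by positivity : (0 : ℝ) < (2 ^ i)⁻¹)]
        gcongr
        rw [abs_of_pos (by linarith)]
        linarith
    have c2 : ((2 : ℝ) ^ i)⁻¹ ≤ 8 / x := by
      rw [inv_le_comm₀ hp (by positivity), inv_div, div_le_iff₀ (by norm_num)]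
      rw [pow_add] at h2
      linarith
    have c3 : 0 ≤ x + y := hmem.2.2.le
    calc ‖psiLP φ (i + 2) x‖ * ‖FT φ (((2 : ℝ) ^ i)⁻¹ * y)‖
        ≤ 2 * B * (B * (8 / x * (x + y))) := by
          gcongr
          · exact norm_psiLP_le hB1 hB _ _
          · refine c1.trans ?_
            gcongr
      _ = _ := by ring
  rw [hsum, symbolSize, Set.indicator_of_mem (by exact hmem), ← ENNReal.ofReal_mul (by positivity)]
  refine (add_le_add (hterm _) (hterm _)).trans ?_
  have h0 : 0 ≤ (x + y) / x := div_nonneg hmem.2.2.le hx.le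
  rw [← ENNReal.ofReal_add (by positivity) (by positivity)]
  exact ENNReal.ofReal_le_ofReal (by linarith)

theorem exists_enorm_paraKernel_le (hφ : IsLPfilter φ) :
    ∃ C : ℝ, 0 < C ∧ ∀ (ε : ℝ) (U V : ℝ × ℝ → ℂ) (z : (ℝ × ℝ) × (ℝ × ℝ)),
      ‖paraKernel φ ε U V z‖ₑ ≤ ENNReal.ofReal C * (symbolSize z *
        (‖halfInd 1 z.1.2 * U z.1‖ₑ * ‖halfInd ε z.2.2 * V z.2‖ₑ)) := by
  obtain ⟨C, hC, h⟩ := exists_sum_symbol_le hφ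
  refine ⟨C, hC, fun ε U V z => ?_⟩
  rcases lt_or_ge z.1.2 0 with hz | hz
  · have : halfInd 1 z.1.2 = 0 := by simp [halfInd, hz]
    simp [paraKernel, this]
  calc ‖paraKernel φ ε U V z‖ₑ
      ≤ ∑' i : ℕ, ‖psiLP φ (i + 2) z.1.2 * FT φ (((2 : ℝ) ^ i)⁻¹ * z.2.2)‖ₑ *
          (‖halfInd 1 z.1.2 * U z.1‖ₑ * ‖halfInd ε z.2.2 * V z.2‖ₑ) := by
        refine enorm_tsum_le_tsum_enorm.trans (ENNReal.tsum_le_tsum fun i => le_of_eq ?_)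
        simp only [enorm_mul]
        ring
    _ ≤ _ := by
        rw [ENNReal.tsum_mul_right, ← mul_assoc (ENNReal.ofReal C)]
        exact mul_le_mul' (h z hz) le_rfl

theorem measurable_blockSymbol (φ : 𝓢(ℝ, ℂ)) (ε : ℝ) (m n : ℕ) :
    Measurable (blockSymbol φ ε m n) := by
  have h1 := (continuous_psiLP φ m).measurable
  have h2 := (continuous_psiLP φ n).measurable
  have h3 := measurable_halfInd ε
  unfold blockSymbol
  fun_prop

theorem enorm_halfInd_mul_le (hφ : IsLPfilter φ) (ε : ℝ) (F : ℝ × ℝ → ℂ) (q : ℝ × ℝ) :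
    ‖halfInd ε q.2 * F q‖ₑ ≤ ∑' p : ℕ × ℕ, ‖blockSymbol φ ε p.1 p.2 q * F q‖ₑ := by
  have key : ∀ ξ, (1 : ℝ≥0∞) ≤ ∑' m, ‖psiLP φ m ξ‖ₑ := fun ξ => by
    have h := (hasSum_psiLP hφ ξ).tsum_eq
    calc (1 : ℝ≥0∞) = ‖∑' m, psiLP φ m ξ‖ₑ := by rw [h]; simp
      _ ≤ _ := enorm_tsum_le_tsum_enorm
  rw [ENNReal.tsum_prod (f := fun m n => ‖blockSymbol φ ε m n q * F q‖ₑ)]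
  calc ‖halfInd ε q.2 * F q‖ₑ = 1 * (1 * ‖halfInd ε q.2 * F q‖ₑ) := by simp
    _ ≤ (∑' m, ‖psiLP φ m q.2‖ₑ) *
        ((∑' n, ‖psiLP φ n (q.1 - ε * q.2 ^ 2)‖ₑ) * ‖halfInd ε q.2 * F q‖ₑ) := by
        gcongr
        · exact key _
        · exact key _
    _ = _ := by
        rw [← ENNReal.tsum_mul_right, ← ENNReal.tsum_mul_right]
        refine tsum_congr fun m => ?_
        rw [← ENNReal.tsum_mul_left]
        refine tsum_congr fun n => ?_
        simp only [blockSymbol, enorm_mul]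
        ring

end Summation

section Assembly

variable {φ : 𝓢(ℝ, ℂ)}

theorem abs_lt_of_psiLP_ne_zero (hφ : IsLPfilter φ) {m : ℕ} {ξ : ℝ} (h : psiLP φ m ξ ≠ 0) :
    |ξ| < 2 * 2 ^ m :=
  lt_of_not_ge fun h' => h (psiLP_eq_zero_of_ge hφ h')

theorem pow_le_of_psiLP_ne_zero (hφ : IsLPfilter φ) {m : ℕ} {ξ : ℝ} (h : psiLP φ m ξ ≠ 0)
    (hm : m ≠ 0) : 2 ^ m ≤ 2 * |ξ| := by
  obtain ⟨n, rfl⟩ := Nat.exists_eq_succ_of_ne_zero hm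
  have : ¬ |ξ| ≤ 2 ^ n := fun h' => h (psiLP_eq_zero_of_le hφ h')
  rw [Nat.succ_eq_add_one, pow_succ]
  linarith

/-- The space–time frequencies with `ξ > 0` seen by the block `Δ^+_{jk}`. -/
def outputSet (m n : ℕ) : Set (ℝ × ℝ) :=
  {q | 0 < q.2 ∧ (m ≠ 0 → 2 ^ m ≤ 2 * q.2) ∧ q.2 ≤ 2 * 2 ^ m ∧ |q.1 - q.2 ^ 2| ≤ 2 * 2 ^ n}

theorem measurableSet_outputSet (m n : ℕ) : MeasurableSet (outputSet m n) := by
  unfold outputSet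
  simp only [imp_iff_not_or, Set.ofPred_and, Set.ofPred_or]
  repeat' first | apply MeasurableSet.inter | apply MeasurableSet.union
  all_goals first
    | exact MeasurableSet.const _
    | exact measurableSet_le (by fun_prop) (by fun_prop)
    | exact measurableSet_lt (by fun_prop) (by fun_prop)

theorem volume_outputSet_lt_top (m n : ℕ) : volume (outputSet m n) < ∞ := by
  have hsub : outputSet m n ⊆ Metric.closedBall (0 : ℝ) (2 * 2 ^ n + (2 * 2 ^ m) ^ 2) ×ˢ
      Metric.closedBall (0 : ℝ) (2 * 2 ^ m) := by
    rintro ⟨a, x⟩ ⟨h1, -, h2, h3⟩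
    simp only at h1 h2 h3
    have h4 : x ^ 2 ≤ (2 * 2 ^ m) ^ 2 := pow_le_pow_left₀ h1.le h2 2
    simp only [Set.mem_prod, mem_closedBall_zero_iff, Real.norm_eq_abs]
    refine ⟨?_, by rwa [abs_of_pos h1]⟩
    rw [abs_le] at h3 ⊢
    constructor <;> nlinarith [sq_nonneg x]
  exact (measure_mono hsub).trans_lt
    ((isCompact_closedBall _ _).prod (isCompact_closedBall _ _)).measure_lt_top

theorem blockSymbol_eq_zero_of_notMem (hφ : IsLPfilter φ) {m n : ℕ} {q : ℝ × ℝ} (hq : 0 < q.2)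
    (h : q ∉ outputSet m n) : blockSymbol φ 1 m n q = 0 := by
  by_contra hne
  simp only [blockSymbol, mul_eq_zero, not_or, one_mul] at hne
  obtain ⟨⟨-, h1⟩, h2⟩ := hne
  have e := abs_of_pos hq
  have h3 := abs_lt_of_psiLP_ne_zero hφ h1
  have h4 := pow_le_of_psiLP_ne_zero hφ h1
  rw [e] at h3 h4
  exact h ⟨hq, h4, h3.le, (abs_lt_of_psiLP_ne_zero hφ h2).le⟩

theorem symbolSize_mul_le (hφ : IsLPfilter φ) (ε : ℝ) {m₀ n₀ : ℕ} (m₁ n₁ m₂ n₂ : ℕ)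
    (U V : ℝ × ℝ → ℂ) {z : (ℝ × ℝ) × (ℝ × ℝ)} (hz : z.1 + z.2 ∈ outputSet m₀ n₀) :
    symbolSize z * (‖blockSymbol φ 1 m₁ n₁ z.1 * U z.1‖ₑ *
        ‖blockSymbol φ ε m₂ n₂ z.2 * V z.2‖ₑ) ≤
      interactionKernel ε m₀ n₀ m₁ n₁ m₂ n₂ z * (‖blockSymbol φ 1 m₁ n₁ z.1 * U z.1‖ₑ *
        ‖blockSymbol φ ε m₂ n₂ z.2 * V z.2‖ₑ) := by
  by_cases hu : blockSymbol φ 1 m₁ n₁ z.1 = 0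
  · simp [hu]
  by_cases hv : blockSymbol φ ε m₂ n₂ z.2 = 0
  · simp [hv]
  refine mul_le_mul' ?_ le_rfl
  refine Set.indicator_apply_le' (fun h => ?_) fun _ => zero_le
  obtain ⟨h1, h2, h3⟩ := h
  simp only [blockSymbol, mul_eq_zero, not_or, one_mul] at hu hv
  obtain ⟨⟨-, hu1⟩, hu2⟩ := hu
  obtain ⟨⟨hv0, hv1⟩, hv2⟩ := hv
  have e : |z.1.2| = z.1.2 := abs_of_nonneg (by linarith)
  have hu3 := abs_lt_of_psiLP_ne_zero hφ hu1
  have hu4 := pow_le_of_psiLP_ne_zero hφ hu1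
  rw [e] at hu3 hu4
  have hu5 : 2 ^ m₁ ≤ 2 * z.1.2 := by
    by_cases hm : m₁ = 0
    · subst hm; rw [pow_zero]; linarith
    · exact hu4 hm
  have hv3 : 0 ≤ ε * z.2.2 := by
    by_contra h
    exact hv0 (by simp [halfInd, h])
  obtain ⟨-, o1, o2, o3⟩ := hz
  rw [interactionKernel, Set.indicator_of_mem]
  exact ⟨h1, h2, h3, hv3, hu5, hu3.le, pow_le_of_psiLP_ne_zero hφ hv1,
    (abs_lt_of_psiLP_ne_zero hφ hv1).le, o1, o2, (abs_lt_of_psiLP_ne_zero hφ hu2).le,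
    (abs_lt_of_psiLP_ne_zero hφ hv2).le, o3⟩

/-- The integrand majorizing the space–time frequency convolution of the paraproduct. -/
def envelopeKernel (ε : ℝ) (U V : ℝ × ℝ → ℂ) (z : (ℝ × ℝ) × (ℝ × ℝ)) : ℝ≥0∞ :=
  symbolSize z * (‖halfInd 1 z.1.2 * U z.1‖ₑ * ‖halfInd ε z.2.2 * V z.2‖ₑ)

/-- A majorant of the space–time Fourier transform of the paraproduct. -/
def envelope (ε : ℝ) (U V : ℝ × ℝ → ℂ) (q : ℝ × ℝ) : ℝ≥0∞ :=
  ∫⁻ r, envelopeKernel ε U V (r, q - r)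

theorem measurable_envelopeKernel (ε : ℝ) {U V : ℝ × ℝ → ℂ} (hU : Measurable U)
    (hV : Measurable V) : Measurable (envelopeKernel ε U V) := by
  have h1 := measurable_halfInd 1
  have h2 := measurable_halfInd ε
  have h3 := measurable_symbolSize
  unfold envelopeKernel
  fun_prop

theorem measurable_envelope (ε : ℝ) {U V : ℝ × ℝ → ℂ} (hU : Measurable U)
    (hV : Measurable V) : Measurable (envelope ε U V) :=
  Measurable.lintegral_prod_right' (f := fun z => envelopeKernel ε U V (z.2, z.1 - z.2))
    ((measurable_envelopeKernel ε hU hV).comp (by fun_prop))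

theorem enorm_halfInd_mul_le_self (ε ξ : ℝ) (a : ℂ) : ‖halfInd ε ξ * a‖ₑ ≤ ‖a‖ₑ := by
  unfold halfInd
  split_ifs <;> simp

theorem exists_envelope_le (ε : ℝ) (U V : 𝓢(ℝ × ℝ, ℂ)) :
    ∃ A : ℝ≥0∞, A ≠ ∞ ∧ ∀ q, envelope ε U V q ≤ A := by
  obtain ⟨M, -, hM⟩ := V.decay 0 0
  have hV : ∀ q, ‖V q‖ₑ ≤ ENNReal.ofReal M := fun q => by
    rw [← ofReal_norm]
    exact ENNReal.ofReal_le_ofReal (by simpa using hM q)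
  have hU : ∫⁻ r, ‖U r‖ₑ < ∞ := (U.integrable (μ := volume)).2
  refine ⟨2 * ENNReal.ofReal M * ∫⁻ r, ‖U r‖ₑ,
    (ENNReal.mul_lt_top (ENNReal.mul_lt_top (by simp) ENNReal.ofReal_lt_top) hU).ne, fun q => ?_⟩
  rw [← lintegral_const_mul _ (by fun_prop)]
  refine lintegral_mono fun r => ?_
  calc envelopeKernel ε U V (r, q - r) ≤ 2 * (‖U r‖ₑ * ENNReal.ofReal M) :=
        mul_le_mul' (symbolSize_le_two _) (mul_le_mul' (enorm_halfInd_mul_le_self _ _ _)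
          ((enorm_halfInd_mul_le_self _ _ _).trans (hV _)))
    _ = 2 * ENNReal.ofReal M * ‖U r‖ₑ := by ring

theorem l2_indicator_envelope_ne_top (ε : ℝ) (U V : 𝓢(ℝ × ℝ, ℂ)) (m n : ℕ) :
    l2 ((outputSet m n).indicator (envelope ε U V)) ≠ ∞ := by
  obtain ⟨A, hA, h⟩ := exists_envelope_le ε U V
  have hle : ∫⁻ q, (outputSet m n).indicator (envelope ε U V) q ^ (2 : ℝ) ≤
      ∫⁻ q, (outputSet m n).indicator (fun _ => A ^ (2 : ℝ)) q := by
    refine lintegral_mono fun q => ?_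
    by_cases hq : q ∈ outputSet m n
    · simp only [Set.indicator_of_mem hq]
      exact ENNReal.rpow_le_rpow (h q) zero_le_two
    · simp [Set.indicator_of_notMem hq]
  refine ENNReal.rpow_ne_top_of_nonneg (by norm_num) (hle.trans_lt ?_).ne
  rw [lintegral_indicator_const (measurableSet_outputSet m n)]
  exact ENNReal.mul_lt_top (ENNReal.rpow_lt_top_of_nonneg zero_le_two hA)
    (volume_outputSet_lt_top m n)

theorem exists_l2_block_le (hφ : IsLPfilter φ) :
    ∃ C : ℝ, 0 < C ∧ ∀ (ε : ℝ) (U V : 𝓢(ℝ × ℝ, ℂ)) (m n : ℕ),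
      (l2 fun q => ‖blockSymbol φ 1 m n q * ∫ r, paraKernel φ ε U V (r, q - r)‖ₑ) ≤
        ENNReal.ofReal C * l2 ((outputSet m n).indicator (envelope ε U V)) := by
  obtain ⟨B, hB1, hB, -⟩ := exists_bound_FT φ
  obtain ⟨C, hC, hK⟩ := exists_enorm_paraKernel_le hφ
  have hB0 : 0 < B := by linarith
  refine ⟨(2 * B) * (2 * B) * C, by positivity, fun ε U V m n => ?_⟩
  have hE := measurable_envelopeKernel ε U.continuous.measurable V.continuous.measurable
  rw [l2, l2]
  have hc : ∀ {c : ℝ≥0∞} {f : ℝ × ℝ → ℝ≥0∞}, Measurable f →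
      (∫⁻ q, (c * f q) ^ (2 : ℝ)) ^ (1 / 2 : ℝ) = c * (∫⁻ q, f q ^ (2 : ℝ)) ^ (1 / 2 : ℝ) := by
    intro c f hf
    simp only [ENNReal.mul_rpow_of_nonneg _ _ (zero_le_two : (0 : ℝ) ≤ 2)]
    rw [lintegral_const_mul _ (hf.pow_const _),
      ENNReal.mul_rpow_of_nonneg _ _ (by norm_num : (0 : ℝ) ≤ 1 / 2), ← ENNReal.rpow_mul]
    norm_num
  rw [← hc ((measurable_envelope ε U.continuous.measurable V.continuous.measurable).indicator
    (measurableSet_outputSet m n))]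
  refine l2_mono fun q => ?_
  rcases le_or_gt q.2 0 with hq | hq
  · rw [integral_eq_zero_of_ae (ae_of_all _ fun r => paraKernel_eq_zero hφ ε U V (by simpa))]
    simp
  by_cases hS : q ∈ outputSet m n
  swap
  · rw [blockSymbol_eq_zero_of_notMem hφ hq hS]
    simp
  rw [Set.indicator_of_mem hS, enorm_mul,
    ENNReal.ofReal_mul (by positivity), mul_assoc]
  refine mul_le_mul' ?_ ?_
  · rw [← ofReal_norm]
    refine ENNReal.ofReal_le_ofReal ?_
    rw [blockSymbol, norm_mul, norm_mul]
    calc ‖halfInd 1 q.2‖ * ‖psiLP φ m q.2‖ * ‖psiLP φ n (q.1 - 1 * q.2 ^ 2)‖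
        ≤ 1 * (2 * B) * (2 * B) := by
          gcongr
          · exact norm_halfInd_le _ _
          · exact norm_psiLP_le hB1 hB _ _
          · exact norm_psiLP_le hB1 hB _ _
      _ = 2 * B * (2 * B) := by ring
  · refine (enorm_integral_le_lintegral_enorm _).trans ?_
    rw [envelope, ← lintegral_const_mul _ (by fun_prop)]
    exact lintegral_mono fun r => hK ε U V (r, q - r)

theorem tsum_mul_tsum_eq {α β : Type*} (a : α → ℝ≥0∞) (b : β → ℝ≥0∞) :
    (∑' i, a i) * ∑' j, b j = ∑' p : α × β, a p.1 * b p.2 := by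
  rw [ENNReal.tsum_prod (f := fun i j => a i * b j), ← ENNReal.tsum_mul_right]
  exact tsum_congr fun i => ENNReal.tsum_mul_left.symm

/-- The modulus of a frequency block of `F`. -/
def blockSize (φ : 𝓢(ℝ, ℂ)) (ε : ℝ) (F : ℝ × ℝ → ℂ) (p : ℕ × ℕ) (q : ℝ × ℝ) : ℝ≥0∞ :=
  ‖blockSymbol φ ε p.1 p.2 q * F q‖ₑ

theorem measurable_blockSize (φ : 𝓢(ℝ, ℂ)) (ε : ℝ) {F : ℝ × ℝ → ℂ} (hF : Measurable F)
    (p : ℕ × ℕ) : Measurable (blockSize φ ε F p) := by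
  have := measurable_blockSymbol φ ε p.1 p.2
  unfold blockSize
  fun_prop

theorem lintegral_sq_le_tsum (hφ : IsLPfilter φ) (ε : ℝ) {U V : ℝ × ℝ → ℂ} (hU : Measurable U)
    (hV : Measurable V) (m n : ℕ) {g : ℝ × ℝ → ℝ≥0∞}
    (hg : g = (outputSet m n).indicator (envelope ε U V)) :
    l2 g * l2 g ≤ ∑' p : (ℕ × ℕ) × (ℕ × ℕ), ∫⁻ q, ∫⁻ r, g q *
      (interactionKernel ε m n p.1.1 p.1.2 p.2.1 p.2.2 (r, q - r) *
        (blockSize φ 1 U p.1 r * blockSize φ ε V p.2 (q - r))) := by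
  have hgm : Measurable g := by
    rw [hg]
    exact (measurable_envelope ε hU hV).indicator (measurableSet_outputSet m n)
  have hIm : ∀ p : (ℕ × ℕ) × (ℕ × ℕ), Measurable fun w : (ℝ × ℝ) × (ℝ × ℝ) => g w.1 *
      (interactionKernel ε m n p.1.1 p.1.2 p.2.1 p.2.2 (w.2, w.1 - w.2) *
        (blockSize φ 1 U p.1 w.2 * blockSize φ ε V p.2 (w.1 - w.2))) := fun p => by
    have h1 := measurable_interactionKernel ε m n p.1.1 p.1.2 p.2.1 p.2.2
    have h2 := measurable_blockSize φ 1 hU p.1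
    have h3 := measurable_blockSize φ ε hV p.2
    fun_prop
  calc l2 g * l2 g = ∫⁻ q, g q ^ (2 : ℝ) := by
        rw [l2, ← ENNReal.rpow_add_of_nonneg _ _ (by norm_num) (by norm_num)]
        norm_num
    _ ≤ ∫⁻ q, ∑' p : (ℕ × ℕ) × (ℕ × ℕ), ∫⁻ r, g q *
          (interactionKernel ε m n p.1.1 p.1.2 p.2.1 p.2.2 (r, q - r) *
            (blockSize φ 1 U p.1 r * blockSize φ ε V p.2 (q - r))) := by
        refine lintegral_mono fun q => ?_
        have hIq : ∀ p : (ℕ × ℕ) × (ℕ × ℕ), Measurable fun r => g q *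
            (interactionKernel ε m n p.1.1 p.1.2 p.2.1 p.2.2 (r, q - r) *
              (blockSize φ 1 U p.1 r * blockSize φ ε V p.2 (q - r))) :=
          fun p => (hIm p).comp measurable_prodMk_left
        rw [← lintegral_tsum fun p => (hIq p).aemeasurable]
        by_cases hq : q ∈ outputSet m n
        swap
        · rw [show g q = 0 by rw [hg, Set.indicator_of_notMem hq]]
          simp
        have e : g q = envelope ε U V q := by rw [hg, Set.indicator_of_mem hq]
        have hE : Measurable fun r => envelopeKernel ε U V (r, q - r) :=
          (measurable_envelopeKernel ε hU hV).comp (by fun_prop)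
        rw [ENNReal.rpow_two, sq]
        nth_rewrite 2 [e]
        rw [envelope, ← lintegral_const_mul _ hE]
        refine lintegral_mono fun r => ?_
        rw [ENNReal.tsum_mul_left]
        refine mul_le_mul' le_rfl ?_
        calc envelopeKernel ε U V (r, q - r)
            ≤ symbolSize (r, q - r) * ((∑' p, blockSize φ 1 U p r) *
                ∑' p, blockSize φ ε V p (q - r)) :=
              mul_le_mul' le_rfl (mul_le_mul' (enorm_halfInd_mul_le hφ _ _ _)
                (enorm_halfInd_mul_le hφ _ _ _))
          _ = ∑' p : (ℕ × ℕ) × (ℕ × ℕ), symbolSize (r, q - r) *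
                (blockSize φ 1 U p.1 r * blockSize φ ε V p.2 (q - r)) := by
              rw [tsum_mul_tsum_eq, ENNReal.tsum_mul_left]
          _ ≤ _ := ENNReal.tsum_le_tsum fun p =>
              symbolSize_mul_le hφ ε _ _ _ _ U V (z := (r, q - r)) (by simpa using hq)
    _ = _ := lintegral_tsum fun p => (Measurable.lintegral_prod_right' (hIm p)).aemeasurable

theorem exists_sum_block_le (hφ : IsLPfilter φ) {s s' : ℝ} (hss' : -(1 / 2 : ℝ) ≤ s + s')
    (hs' : s' ≤ -(1 / 2 : ℝ)) {ε : ℝ} (hε : ε = 1 ∨ ε = -1) :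
    ∃ C : ℝ, 0 < C ∧ ∀ U V : 𝓢(ℝ × ℝ, ℂ),
      ∑' p : ℕ × ℕ, ENNReal.ofReal (weight (s + s' + 1) (-(1 / 2)) p.1 p.2) *
          l2 ((outputSet p.1 p.2).indicator (envelope ε U V)) ≤
        ENNReal.ofReal C *
          ((∑' p : ℕ × ℕ, ENNReal.ofReal (weight s (1 / 2) p.1 p.2) * l2 (blockSize φ 1 U p)) *
            ∑' p : ℕ × ℕ, ENNReal.ofReal (weight s' (1 / 2) p.1 p.2) *
              l2 (blockSize φ ε V p)) := by
  obtain ⟨C, hC, h⟩ := exists_weighted_trilinear_le hss' hs' hε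
  refine ⟨C * 1200, by positivity, fun U V => ?_⟩
  have hU : Measurable U := U.continuous.measurable
  have hV : Measurable V := V.continuous.measurable
  set X : ℕ × ℕ → ℝ≥0∞ := fun p =>
    ENNReal.ofReal (weight s (1 / 2) p.1 p.2) * l2 (blockSize φ 1 U p)
  set Y : ℕ × ℕ → ℝ≥0∞ := fun p =>
    ENNReal.ofReal (weight s' (1 / 2) p.1 p.2) * l2 (blockSize φ ε V p)
  have key : ∀ p₀ : ℕ × ℕ, ENNReal.ofReal (weight (s + s' + 1) (-(1 / 2)) p₀.1 p₀.2) *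
      l2 ((outputSet p₀.1 p₀.2).indicator (envelope ε U V)) ≤
      ∑' p : (ℕ × ℕ) × (ℕ × ℕ), ENNReal.ofReal C *
        ENNReal.ofReal (offDiag p₀.1 p₀.2 p.1.1 p.2.1) * (X p.1 * Y p.2) := by
    intro p₀
    set g := (outputSet p₀.1 p₀.2).indicator (envelope ε U V) with hg
    have hgm : Measurable g :=
      (measurable_envelope ε hU hV).indicator (measurableSet_outputSet _ _)
    have htop : l2 g ≠ ∞ := l2_indicator_envelope_ne_top ε U V _ _
    rcases eq_or_ne (l2 g) 0 with h0 | h0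
    · rw [h0, mul_zero]; exact zero_le
    rw [← ENNReal.mul_le_mul_iff_left h0 htop, mul_assoc, ← ENNReal.tsum_mul_right]
    refine (mul_le_mul' le_rfl (lintegral_sq_le_tsum hφ ε hU hV _ _ hg)).trans ?_
    rw [← ENNReal.tsum_mul_left]
    exact ENNReal.tsum_le_tsum fun p => h _ _ _ _ _ _ _ _ _ hgm
      (measurable_blockSize φ 1 hU p.1) (measurable_blockSize φ ε hV p.2)
  calc _ ≤ ∑' p₀ : ℕ × ℕ, ∑' p : (ℕ × ℕ) × (ℕ × ℕ), ENNReal.ofReal C *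
        ENNReal.ofReal (offDiag p₀.1 p₀.2 p.1.1 p.2.1) * (X p.1 * Y p.2) :=
        ENNReal.tsum_le_tsum key
    _ = ∑' p : (ℕ × ℕ) × (ℕ × ℕ), ENNReal.ofReal C *
        (∑' p₀ : ℕ × ℕ, ENNReal.ofReal (offDiag p₀.1 p₀.2 p.1.1 p.2.1)) * (X p.1 * Y p.2) := by
        rw [ENNReal.tsum_comm]
        refine tsum_congr fun p => ?_
        rw [ENNReal.tsum_mul_right, ENNReal.tsum_mul_left]
    _ ≤ ∑' p : (ℕ × ℕ) × (ℕ × ℕ), ENNReal.ofReal C * ENNReal.ofReal 1200 * (X p.1 * Y p.2) :=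
        ENNReal.tsum_le_tsum fun p => mul_le_mul' (mul_le_mul' le_rfl (tsum_offDiag_le _ _)) le_rfl
    _ = ENNReal.ofReal (C * 1200) * ((∑' p, X p) * ∑' p, Y p) := by
        rw [ENNReal.tsum_mul_left, tsum_mul_tsum_eq, ENNReal.ofReal_mul hC.le]

theorem XNorm_eq_tsum (φ : 𝓢(ℝ, ℂ)) (σ b : ℝ) (w : ℝ × ℝ → ℂ) :
    XNorm φ σ b w = ∑' p : ℕ × ℕ, ENNReal.ofReal (weight σ b p.1 p.2) *
      eLpNorm (fun x : ℝ × ℝ => Xblock φ 1 p.1 p.2 w x + Xblock φ (-1) p.1 p.2 w x) 2 volume :=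
  (ENNReal.tsum_prod (f := fun m n => ENNReal.ofReal (weight σ b m n) *
    eLpNorm (fun x : ℝ × ℝ => Xblock φ 1 m n w x + Xblock φ (-1) m n w x) 2 volume)).symm

theorem tsum_blockSize_le_XNorm (hφ : IsLPfilter φ) (σ b : ℝ) {ε : ℝ} (hε : ε = 1 ∨ ε = -1)
    (w : ℝ × ℝ → ℂ) :
    ∑' p : ℕ × ℕ, ENNReal.ofReal (weight σ b p.1 p.2) * l2 (blockSize φ ε (FT2 w) p) ≤
      XNorm φ σ b w := by
  rw [XNorm_eq_tsum]
  exact ENNReal.tsum_le_tsum fun p => mul_le_mul' le_rfl (l2_blockSymbol_le hφ hε p.1 p.2 w)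

theorem exists_XNorm_paraT_le (hφ : IsLPfilter φ) {s s' : ℝ} (hss' : -(1 / 2 : ℝ) ≤ s + s')
    (hs' : s' ≤ -(1 / 2 : ℝ)) {ε : ℝ} (hε : ε = 1 ∨ ε = -1) :
    ∃ C : ℝ, 0 < C ∧ ∀ u v : 𝓢(ℝ × ℝ, ℂ),
      XNorm φ (s + s' + 1) (-(1 / 2)) (Pproj 1 (paraT φ (Pproj ε ⇑v) (Pproj 1 ⇑u))) ≤
        ENNReal.ofReal C * XNorm φ s (1 / 2) ⇑u * XNorm φ s' (1 / 2) ⇑v := by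
  obtain ⟨C₁, hC₁, h₁⟩ := exists_l2_block_le hφ
  obtain ⟨C₂, hC₂, h₂⟩ := exists_sum_block_le hφ hss' hs' hε
  refine ⟨C₁ * C₂, by positivity, fun u v => ?_⟩
  obtain ⟨U, hU, hU'⟩ := exists_schwartz_FT2 u
  obtain ⟨V, hV, hV'⟩ := exists_schwartz_FT2 v
  rw [Pproj_paraT_eq_FT2inv hφ ε hU' hV', XNorm_eq_tsum]
  have hG0 : ∀ q : ℝ × ℝ, q.2 ≤ 0 → ∫ r, paraKernel φ ε U V (r, q - r) = 0 := fun q hq =>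
    integral_eq_zero_of_ae (ae_of_all _ fun r => paraKernel_eq_zero hφ ε U V (by simpa))
  calc _ ≤ ∑' p : ℕ × ℕ, ENNReal.ofReal (weight (s + s' + 1) (-(1 / 2)) p.1 p.2) *
        (ENNReal.ofReal C₁ * l2 ((outputSet p.1 p.2).indicator (envelope ε U V))) :=
        ENNReal.tsum_le_tsum fun p => mul_le_mul' le_rfl
          ((eLpNorm_block_FT2inv_le hφ _ _ (integrable_paraKernel_integral hφ ε U V) hG0).trans
            (h₁ ε U V _ _))
    _ = ENNReal.ofReal C₁ * ∑' p : ℕ × ℕ,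
        ENNReal.ofReal (weight (s + s' + 1) (-(1 / 2)) p.1 p.2) *
          l2 ((outputSet p.1 p.2).indicator (envelope ε U V)) := by
        rw [← ENNReal.tsum_mul_left]
        exact tsum_congr fun p => mul_left_comm _ _ _
    _ ≤ ENNReal.ofReal C₁ * (ENNReal.ofReal C₂ *
        (XNorm φ s (1 / 2) u * XNorm φ s' (1 / 2) v)) := by
        refine mul_le_mul' le_rfl ((h₂ U V).trans (mul_le_mul' le_rfl (mul_le_mul' ?_ ?_)))
        · rw [hU]; exact tsum_blockSize_le_XNorm hφ s _ (Or.inl rfl) u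
        · rw [hV]; exact tsum_blockSize_le_XNorm hφ s' _ hε v
    _ = _ := by rw [ENNReal.ofReal_mul hC₁.le]; ring

end Assembly

/-- **Bourgain-space product estimate for the paraproduct term**: for
`s + s' ≥ -1/2` and `s' ≤ -1/2`,
`‖P^+(T_{P^± v} P^+ u)‖_{X^{s+s'+1,-1/2,1}} ≤ C ‖u‖_{X^{s,1/2,1}} ‖v‖_{X^{s',1/2,1}}`. -/
theorem bourgain_product_paraproduct
    (φ : 𝓢(ℝ, ℂ)) (hφ : IsLPfilter φ)
    (s s' : ℝ) (hss' : -(1 / 2 : ℝ) ≤ s + s') (hs' : s' ≤ -(1 / 2 : ℝ))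
    (ε : ℝ) (hε : ε = 1 ∨ ε = -1) :
    ∃ C : ℝ, 0 < C ∧
      ∀ u v : 𝓢(ℝ × ℝ, ℂ),
        XNorm φ (s + s' + 1) (-(1 / 2)) (Pproj 1 (paraT φ (Pproj ε ⇑v) (Pproj 1 ⇑u)))
          ≤ ENNReal.ofReal C * XNorm φ s (1 / 2) ⇑u * XNorm φ s' (1 / 2) ⇑v :=
  exists_XNorm_paraT_le hφ hss' hs' hε

end
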